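/- Let X be the two-sided full shift on two symbols. For any finite set of positive real numbers α<β_1<β_2<⋯<β_N there exists a continuous potential φ:X→ℝ such that, for β≥α, the only points of non-differentiability of the pressure function β↦P_top(βφ) are β_1,…,β_N. -/

import Mathlib

open MeasureTheory Real Filter Topology

noncomputable section

namespace PhaseTransitions

/-! ### Measure-theoretic entropy and topological pressure -/

/-- Base-2 entropy of the (finite, measurable) partition of `X` induced by an
observable `f : X → F` with finitely many values. -/
def entOfObs {X F : Type*} [MeasurableSpace X] [Fintype F]
    (μ : Measure X) (f : X → F) : ℝ :=
  ∑ a : F, -((μ (f ⁻¹' {a})).toReal * Real.logb 2 (μ (f ⁻¹' {a})).toReal)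

/-- Entropy of the transformation `T` with respect to the partition induced by
the observable `f` : the limit (= infimum) of `(1/n) H(⋁_{i<n} T⁻ⁱ f)`. -/
def entObsT {X F : Type*} [MeasurableSpace X] [Fintype F]
    (T : X → X) (μ : Measure X) (f : X → F) : ℝ :=
  ⨅ n : ℕ, entOfObs μ (fun x => fun i : Fin (n + 1) => f (T^[(i : ℕ)] x)) / (n + 1)

/-- Kolmogorov–Sinai (measure-theoretic) entropy, base 2: supremum over all
finite measurable partitions (encoded by observables with values in `Fin k`). -/
def kolSinai {X : Type*} [MeasurableSpace X] (T : X → X) (μ : Measure X) : ℝ :=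
  ⨆ k : ℕ, ⨆ f : {f : X → Fin k // Measurable f}, entObsT T μ f.1

/-- `μ` is a `T`-invariant Borel probability measure. -/
def InvProb {X : Type*} [MeasurableSpace X] (T : X → X) (μ : Measure X) : Prop :=
  IsProbabilityMeasure μ ∧ MeasurePreserving T μ μ

/-- Topological pressure, via the variational principle. -/
def pressure {X : Type*} [MeasurableSpace X] (T : X → X) (φ : X → ℝ) : ℝ :=
  ⨆ μ : {μ : Measure X // InvProb T μ}, (kolSinai T μ.1 + ∫ x, φ x ∂μ.1)

/-- An equilibrium state of the potential `φ`: an invariant probability measure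
attaining the supremum in the variational principle. -/
def IsEquilibrium {X : Type*} [MeasurableSpace X] (T : X → X) (φ : X → ℝ)
    (μ : Measure X) : Prop :=
  InvProb T μ ∧ kolSinai T μ + ∫ x, φ x ∂μ = pressure T φ

/-! ### The two-sided full shift on two symbols -/

/-- The two-sided full shift space `{0,1}^ℤ`. -/
abbrev Bin : Type := ℤ → Bool

/-- The (left) shift map. -/
def shift (x : Bin) : Bin := fun n => x (n + 1)

/-- `x` is a bi-infinite free concatenation of words from `W`: there is a
bi-infinite increasing sequence of cut points, cofinal in both directions, such
that consecutive cut points delimit words of `W`. -/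
def IsFreeConcat (W : Set (List Bool)) (x : Bin) : Prop :=
  ∃ t : ℤ → ℤ, StrictMono t ∧ (∀ N : ℤ, ∃ k, N < t k) ∧ (∀ N : ℤ, ∃ k, t k < N) ∧
    ∀ k : ℤ, ∃ w ∈ W, t (k + 1) = t k + w.length ∧
      ∀ (i : ℕ) (h : i < w.length), x (t k + (i : ℤ)) = w.get ⟨i, h⟩

/-- The coded system generated by the word set `W`: the closure of the set of
free concatenations of words from `W`. -/
def codedSystem (W : Set (List Bool)) : Set Bin :=
  closure {x | IsFreeConcat W x}

/-- The generating set `W_n = {0^{2^n-1}1, 1^{2^n-1}0}`. -/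
def genWords (n : ℕ) : Set (List Bool) :=
  {List.replicate (2 ^ n - 1) false ++ [true], List.replicate (2 ^ n - 1) true ++ [false]}

/-- The subshift `X_n`, the coded system generated by `W_n`. -/
def Xsub (n : ℕ) : Set Bin := codedSystem (genWords n)

/-- The set of words of length `j` in the language of `Y ⊆ {0,1}^ℤ`. -/
def langWord (Y : Set Bin) (j : ℕ) : Set (Fin j → Bool) :=
  {w | ∃ x ∈ Y, ∀ i : Fin j, x ((i : ℕ) : ℤ) = w i}

/-! ### The metric and the potential -/

open Classical in
/-- The metric `d(x,y) = 2^{-inf{|n| : x_n ≠ y_n}}` on the shift space. -/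
def binDist (x y : Bin) : ℝ :=
  if x = y then 0
  else (1 / 2 : ℝ) ^ sInf {m : ℕ | ∃ i : ℤ, i.natAbs = m ∧ x i ≠ y i}

/-- Distance from a point to a set. -/
def distToSet (x : Bin) (S : Set Bin) : ℝ :=
  sInf ((fun y => binDist x y) '' S)

/-- `δ_j = (10 + 3 log₂ j)/(α j)`. -/
def deltaSeq (α : ℝ) (j : ℕ) : ℝ := (10 + 3 * Real.logb 2 j) / (α * j)

/-- The drop `δ` as a function of the distance `r`: if `r = 2^{-j}` this equals
`δ_j = (10 + 3 log₂ j)/(α j)`, and `δ = 0` when `r = 0` (i.e. `δ_∞ = 0`). -/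
def deltaOf (α : ℝ) (r : ℝ) : ℝ :=
  if r = 0 then 0
  else (10 + 3 * Real.logb 2 (-Real.logb 2 r)) / (α * (-Real.logb 2 r))

/-- `c_n = -∑_{j=n}^∞ 1/(2^{j+1} β_j)`. -/
def cseq (β : ℕ → ℝ) (n : ℕ) : ℝ :=
  -∑' k : ℕ, 1 / (2 ^ (n + k + 1) * β (n + k))

/-- `φ_n(x) = c_n − δ_j` when `dist(x, X_n) = 2^{-j}` (and `φ_n = c_n` on `X_n`). -/
def phiN (α : ℝ) (c : ℕ → ℝ) (n : ℕ) (x : Bin) : ℝ :=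
  c n - deltaOf α (distToSet x (Xsub n))

/-- The potential `φ = sup_{n ≥ 1} φ_n`. -/
def phi (α : ℝ) (c : ℕ → ℝ) (x : Bin) : ℝ :=
  ⨆ n : ℕ, phiN α c (n + 1) x

/-- The constants of the finite (truncated) construction:
`c_{n} = c_1 + ∑_{j=1}^{n-1} 1/(2^{j+1} β_j)`. -/
def cseqFin (c1 : ℝ) (β : ℕ → ℝ) (n : ℕ) : ℝ :=
  c1 + ∑ j ∈ Finset.Ico 1 n, 1 / (2 ^ (j + 1) * β j)

/-- The truncated potential `φ = max{φ_n : 1 ≤ n ≤ N+1}`. -/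
def phiFin (α : ℝ) (c : ℕ → ℝ) (N : ℕ) (x : Bin) : ℝ :=
  ⨆ n : Fin (N + 1), phiN α c ((n : ℕ) + 1) x

/-! ### Measures of maximal entropy and relative pressure -/

/-- `μ` is a measure of maximal entropy for the subsystem `Y` (a `T`-invariant
probability measure giving full mass to `Y` and maximizing entropy among such). -/
def IsMaxEntropyOn (Y : Set Bin) (μ : Measure Bin) : Prop :=
  InvProb shift μ ∧ μ Y = 1 ∧
    ∀ ν : Measure Bin, InvProb shift ν → ν Y = 1 → kolSinai shift ν ≤ kolSinai shift μ

/-- The topological pressure of the subsystem `Y` (computed via the variational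
principle over invariant measures giving full mass to `Y`). -/
def pressureOn (Y : Set Bin) (φ : Bin → ℝ) : ℝ :=
  ⨆ μ : {μ : Measure Bin // InvProb shift μ ∧ μ Y = 1},
    (kolSinai shift μ.1 + ∫ x, φ x ∂μ.1)

/-! ### The pin-sequence space -/

/-- `Y`, the closure of the union of the `X_n`, `n ≥ 1`. -/
def Yset : Set Bin := closure (⋃ n : ℕ, Xsub (n + 1))

/-- The word `x_i ⋯ x_j` belongs to the language of `Y`. -/
def SegIn (x : Bin) (i j : ℤ) (Y : Set Bin) : Prop :=
  ∃ y ∈ Y, ∀ m : ℤ, i ≤ m → m ≤ j → y (m - i) = x m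

/-- The word `x_0 ⋯ x_{j-1}` belongs to the language of `Y`. -/
def WordIn (x : Bin) (j : ℕ) (Y : Set Bin) : Prop :=
  ∃ y ∈ Y, ∀ m : ℕ, m < j → y (m : ℤ) = x (m : ℤ)

/-- The pin-sequence space `P ⊆ X × {0,1}^ℤ`: pinless stretches of `x` lie in the
language of `Y`, and stretches between two pins do not. -/
def PinSpace : Set (Bin × Bin) :=
  {p | (∀ i j : ℤ, i < j → (∀ k : ℤ, i < k → k ≤ j → p.2 k = false) → SegIn p.1 i j Yset) ∧
       (∀ i j : ℤ, i < j → p.2 i = true → p.2 j = true → ¬ SegIn p.1 i j Yset)}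

/-- The product shift `T̄(x,z) = (Tx, Tz)`. -/
def shift2 (p : Bin × Bin) : Bin × Bin := (shift p.1, shift p.2)

/-- The set `A = {(x,z) ∈ P : z_0 = 1}`. -/
def Aset : Set (Bin × Bin) := {p | p ∈ PinSpace ∧ p.2 0 = true}

/-- The first return time to `A`. -/
def retTime (p : Bin × Bin) : ℕ :=
  sInf {k : ℕ | 1 ≤ k ∧ shift2^[k] p ∈ Aset}

/-- The induced (first-return) map `T̄_A`. -/
def inducedMap (p : Bin × Bin) : Bin × Bin := shift2^[retTime p] p

/-- `Q_j`, the set of points of `A` with first return time `j`. -/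
def Qset (j : ℕ) : Set (Bin × Bin) := {p | p ∈ Aset ∧ retTime p = j}

/-- `Q_{j,s}` for `1 ≤ s ≤ ⌊log₂ j⌋ - 3`: points of `Q_j` whose initial block of
length `j` lies in the language of `X_s`; the class `s = 0` collects the blocks
belonging to some `X_{s'}` with `s' ≥ ⌊log₂ j⌋ - 2`. -/
def Qjs (j s : ℕ) : Set (Bin × Bin) :=
  if s = 0 then
    {p | p ∈ Qset j ∧ ∃ s' : ℕ, 1 ≤ s' ∧ Nat.log 2 j - 2 ≤ s' ∧ WordIn p.1 j (Xsub s')}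
  else {p | p ∈ Qset j ∧ WordIn p.1 j (Xsub s)}


/-! ### The full shift -/

lemma shift_iterate_apply (n : ℕ) (x : Bin) (i : ℤ) : shift^[n] x i = x (i + n) := by
  induction n generalizing x with
  | zero => simp
  | succ n ih =>
    rw [Function.iterate_succ_apply, ih, shift]
    congr 1
    push_cast
    ring

lemma measurable_shift : Measurable shift :=
  measurable_pi_lambda _ fun n => measurable_pi_apply (n + 1)

lemma continuous_of_dependsOn {Y : Type*} [TopologicalSpace Y] {f : Bin → Y} {s : Set ℤ}
    (hs : s.Finite) (h : DependsOn f s) : Continuous f := by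
  refine continuous_iff_continuousAt.2 fun x => ?_
  have hx : ∀ᶠ y in 𝓝 x, ∀ i ∈ s, y i = x i := by
    rw [Filter.eventually_all_finite hs]
    intro i _
    exact (continuous_apply i).continuousAt.eventually
      (show ∀ᶠ b in 𝓝 (x i), b = x i by simp [nhds_discrete])
  exact continuousAt_const.congr (hx.mono fun y hy => (h fun i hi => hy i hi).symm)

/-- The point whose past is the past of `x` followed by the symbol `b`. -/
def snoc (b : Bool) (x : Bin) : Bin := Function.update (shift x) 0 b

lemma snoc_zero (b : Bool) (x : Bin) : snoc b x 0 = b := by simp [snoc]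

lemma snoc_of_ne (b : Bool) (x : Bin) {i : ℤ} (hi : i ≠ 0) : snoc b x i = x (i + 1) := by
  simp [snoc, hi, shift]

lemma snoc_eq_shift_of_le {x y : Bin} (h : ∀ i ≤ 0, x i = y i) :
    ∀ i ≤ 0, snoc (y 1) x i = shift y i := by
  intro i hi
  rcases eq_or_ne i 0 with rfl | h0
  · simp [snoc_zero, shift]
  · rw [snoc_of_ne _ _ h0, shift]
    exact h _ (by omega)

/-! ### The Gibbs inequality -/

lemma sum_neg_mul_logb_le {F : Type*} [Fintype F] (p q : F → ℝ) (hp : ∀ a, 0 ≤ p a)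
    (hp1 : ∑ a, p a = 1) (hq : ∀ a, 0 < q a) (hq1 : ∑ a, q a ≤ 1) :
    ∑ a, -(p a * Real.logb 2 (p a)) ≤ ∑ a, p a * -Real.logb 2 (q a) := by
  have h2 : 0 < Real.log 2 := Real.log_pos one_lt_two
  have key : ∀ a, -(p a * Real.logb 2 (p a)) - p a * -Real.logb 2 (q a)
      ≤ (q a - p a) / Real.log 2 := by
    intro a
    rw [le_div_iff₀ h2]
    rcases (hp a).eq_or_lt with h0 | h0
    · rw [← h0]
      simpa using (hq a).le
    · have hl := Real.log_le_sub_one_of_pos (div_pos (hq a) h0)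
      rw [Real.log_div (hq a).ne' h0.ne'] at hl
      have hm := mul_le_mul_of_nonneg_left hl h0.le
      have e1 : p a * (q a / p a - 1) = q a - p a := by field_simp
      rw [e1] at hm
      have e2 : (-(p a * Real.logb 2 (p a)) - p a * -Real.logb 2 (q a)) * Real.log 2
          = p a * (Real.log (q a) - Real.log (p a)) := by
        simp only [Real.logb]
        field_simp
        ring
      rw [e2]
      exact hm
  have hs := Finset.sum_le_sum fun a (_ : a ∈ Finset.univ) => key a
  rw [Finset.sum_sub_distrib, ← Finset.sum_div, Finset.sum_sub_distrib, hp1] at hs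
  have : (∑ a, q a - 1) / Real.log 2 ≤ 0 := div_nonpos_of_nonpos_of_nonneg (by linarith) h2.le
  linarith

lemma entOfObs_le_integral {X F : Type*} [MeasurableSpace X] [Fintype F] [MeasurableSpace F]
    [MeasurableSingletonClass F] {μ : Measure X} [IsProbabilityMeasure μ] {f : X → F}
    (hf : Measurable f) {q : F → ℝ} (hq : ∀ a, 0 < q a) (hq1 : ∑ a, q a ≤ 1) {G : X → ℝ}
    (hG : Integrable G μ) (hle : ∀ x, -Real.logb 2 (q (f x)) ≤ G x) :
    entOfObs μ f ≤ ∫ x, G x ∂μ := by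
  have hprob : IsProbabilityMeasure (μ.map f) := Measure.isProbabilityMeasure_map hf.aemeasurable
  have hreal : ∀ a, (μ (f ⁻¹' {a})).toReal = (μ.map f).real {a} := fun a => by
    rw [Measure.real, Measure.map_apply hf (measurableSet_singleton a)]
  have hint : Integrable (fun a => -Real.logb 2 (q a)) (μ.map f) := .of_finite
  calc entOfObs μ f
      = ∑ a, -((μ.map f).real {a} * Real.logb 2 ((μ.map f).real {a})) := by
        simp only [entOfObs, hreal]
    _ ≤ ∑ a, (μ.map f).real {a} * -Real.logb 2 (q a) := by
        refine sum_neg_mul_logb_le _ _ (fun a => measureReal_nonneg) ?_ hq hq1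
        rw [sum_measureReal_singleton]
        simp
    _ = ∫ a, -Real.logb 2 (q a) ∂(μ.map f) := by
        rw [integral_fintype hint]
        simp
    _ = ∫ x, -Real.logb 2 (q (f x)) ∂μ :=
        integral_map hf.aemeasurable hint.aestronglyMeasurable
    _ ≤ ∫ x, G x ∂μ := integral_mono (hint.comp_measurable hf) hG hle

/-! ### Approximation of observables by local ones -/

lemma exists_dependsOn_measure_lt (μ : Measure Bin) [IsProbabilityMeasure μ] {s : Set Bin}
    (hs : MeasurableSet s) {ε : ℝ} (hε : 0 < ε) :
    ∃ (I : Finset ℤ) (t : Set Bin), DependsOn (fun x => x ∈ t) (I : Set ℤ) ∧ MeasurableSet t ∧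
      μ.real (symmDiff s t) < ε := by
  have hd := Measure.MeasureDense.of_generateFrom_isSetAlgebra_finite μ
    (isSetAlgebra_measurableCylinders (α := fun _ : ℤ => Bool))
    (generateFrom_measurableCylinders (α := fun _ : ℤ => Bool)).symm
  obtain ⟨t, ht, hlt⟩ := hd.approx s hs (measure_ne_top _ _) ε hε
  obtain ⟨I, S, hS, rfl⟩ := (mem_measurableCylinders t).1 ht
  refine ⟨I, _, fun x y hxy => ?_, hd.measurable _ ht, ?_⟩
  · have : I.restrict x = I.restrict y := funext fun i => hxy i i.2
    simp only [mem_cylinder, this]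
  · exact (ENNReal.toReal_lt_of_lt_ofReal hlt)

open Classical in
lemma exists_local_observable (μ : Measure Bin) [IsProbabilityMeasure μ] {k : ℕ}
    {f : Bin → Fin k} (hf : Measurable f) {ε : ℝ} (hε : 0 < ε) :
    ∃ (I : Finset ℤ) (f' : Bin → Fin k), DependsOn f' (I : Set ℤ) ∧
      μ.real {x | f' x ≠ f x} < ε := by
  obtain ⟨x₀⟩ : Nonempty Bin := inferInstance
  have hk : 0 < k := (f x₀).pos
  have hk' : (0 : ℝ) < k := by exact_mod_cast hk
  choose I t hdep ht hlt using fun a : Fin k =>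
    exists_dependsOn_measure_lt μ (hf (measurableSet_singleton a)) (div_pos hε hk')
  let f' : Bin → Fin k := fun x => if h : ∃ a, x ∈ t a then h.choose else f x₀
  refine ⟨Finset.univ.biUnion I, f', fun x y hxy => ?_, ?_⟩
  · have : (fun a => x ∈ t a) = fun a => y ∈ t a := funext fun a =>
      hdep a fun i hi => hxy i (by simpa using ⟨a, hi⟩)
    simp only [f', this]
  · have hsub : {x | f' x ≠ f x} ⊆ ⋃ a, symmDiff (f ⁻¹' {a}) (t a) := by
      intro x hx
      by_contra hcon
      simp only [Set.mem_iUnion, not_exists, Set.mem_symmDiff, Set.mem_preimage,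
        Set.mem_singleton_iff] at hcon
      have hiff : ∀ a, x ∈ t a ↔ f x = a := fun a => by
        have := hcon a
        tauto
      have hex : ∃ a, x ∈ t a := ⟨f x, (hiff _).2 rfl⟩
      apply hx
      simp only [f', hex, dite_true]
      exact ((hiff _).1 hex.choose_spec).symm
    calc μ.real {x | f' x ≠ f x} ≤ μ.real (⋃ a, symmDiff (f ⁻¹' {a}) (t a)) :=
          measureReal_mono hsub
      _ ≤ ∑ a, μ.real (symmDiff (f ⁻¹' {a}) (t a)) := measureReal_iUnion_fintype_le _
      _ < ∑ a : Fin k, ε / k :=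
        Finset.sum_lt_sum_of_nonempty ⟨f x₀, Finset.mem_univ _⟩ fun a _ => hlt a
      _ = ε := by
        rw [Finset.sum_const, Finset.card_univ, Fintype.card_fin, nsmul_eq_mul]
        field_simp

/-- Every observable is, up to small measure, a local function of the past of a later point of
the orbit. -/
lemma exists_past_observable (μ : Measure Bin) [IsProbabilityMeasure μ] {k : ℕ}
    {f : Bin → Fin k} (hf : Measurable f) {ε : ℝ} (hε : 0 < ε) :
    ∃ (r m : ℕ) (f' : Bin → Fin k), DependsOn f' (Set.Icc (-(r : ℤ)) 0) ∧
      μ.real {x | f' (shift^[m + 1] x) ≠ f x} < ε := by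
  obtain ⟨I, f', hdep, hlt⟩ := exists_local_observable μ hf hε
  obtain ⟨m, hm⟩ : ∃ m : ℕ, ∀ i ∈ I, i.natAbs ≤ m :=
    ⟨I.sup Int.natAbs, fun i hi => Finset.le_sup (f := Int.natAbs) hi⟩
  refine ⟨2 * m + 1, m, fun x => f' fun i => x (i - (m + 1)), fun x y hxy => ?_, ?_⟩
  · refine hdep fun i hi => hxy _ ?_
    have := hm i hi
    constructor <;> push_cast <;> omega
  · have key : ∀ x : Bin, (fun i : ℤ => shift^[m + 1] x (i - (m + 1))) = x := fun x => by
      funext i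
      rw [shift_iterate_apply]
      congr 1
      push_cast
      ring
    simpa only [key] using hlt

/-! ### The entropy bound -/

lemma entOfObs_nonneg {X F : Type*} [MeasurableSpace X] [Fintype F] (μ : Measure X)
    [IsProbabilityMeasure μ] (f : X → F) : 0 ≤ entOfObs μ f := by
  refine Finset.sum_nonneg fun a _ => neg_nonneg.2 ?_
  exact mul_nonpos_of_nonneg_of_nonpos ENNReal.toReal_nonneg
    (Real.logb_nonpos one_lt_two ENNReal.toReal_nonneg
      (ENNReal.toReal_le_of_le_ofReal zero_le_one (by simpa using prob_le_one)))

lemma entObsT_le_div {X F : Type*} [MeasurableSpace X] [Fintype F] (T : X → X) (μ : Measure X)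
    [IsProbabilityMeasure μ] (f : X → F) (n : ℕ) :
    entObsT T μ f ≤ entOfObs μ (fun x => fun i : Fin (n + 1) => f (T^[(i : ℕ)] x)) / (n + 1) := by
  refine ciInf_le ⟨0, ?_⟩ n
  rintro _ ⟨m, rfl⟩
  exact div_nonneg (entOfObs_nonneg _ _) (by positivity)

/-- The weight of the word `v`, summed over all ways to extend the past of `y`: each new symbol
has the conditional weight `g` and emits the letter `a` with weight `κ a`. -/
def wordWeight {F : Type*} (g : Bin → ℝ) (κ : F → Bin → ℝ) : (n : ℕ) → (Fin n → F) → Bin → ℝ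
  | 0, _, _ => 1
  | n + 1, v, y => ∑ b : Bool,
      g (snoc b y) * κ (v 0) (snoc b y) * wordWeight g κ n (Fin.tail v) (snoc b y)

lemma sum_wordWeight_le {F : Type*} [Fintype F] {g : Bin → ℝ} {κ : F → Bin → ℝ}
    (hg : ∀ x, 0 ≤ g x) (hsum : ∀ x, ∑ b, g (snoc b x) ≤ 1) (hκ : ∀ x, ∑ a, κ a x = 1)
    (n : ℕ) (y : Bin) : ∑ v, wordWeight g κ n v y ≤ 1 := by
  induction n generalizing y with
  | zero => simp [wordWeight]
  | succ n ih =>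
    rw [← (Fin.consEquiv fun _ : Fin (n + 1) => F).sum_comp, Fintype.sum_prod_type]
    simp only [Fin.consEquiv_apply, wordWeight, Fin.cons_zero]
    calc ∑ a, ∑ v, ∑ b, g (snoc b y) * κ a (snoc b y) * wordWeight g κ n v (snoc b y)
        = ∑ b, ∑ a, ∑ v, g (snoc b y) * κ a (snoc b y) * wordWeight g κ n v (snoc b y) :=
          (Finset.sum_congr rfl fun _ _ => Finset.sum_comm).trans Finset.sum_comm
      _ = ∑ b, g (snoc b y) * ∑ v, wordWeight g κ n v (snoc b y) := by
          refine Finset.sum_congr rfl fun b _ => ?_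
          simp_rw [← Finset.mul_sum, ← Finset.sum_mul, ← Finset.mul_sum, hκ, mul_one]
      _ ≤ ∑ b, g (snoc b y) := Finset.sum_le_sum fun b _ =>
          mul_le_of_le_one_right (hg _) (ih _)
      _ ≤ 1 := hsum y

lemma wordWeight_nonneg {F : Type*} {g : Bin → ℝ} {κ : F → Bin → ℝ} (hg : ∀ x, 0 ≤ g x)
    (hκ : ∀ a x, 0 ≤ κ a x) (n : ℕ) (v : Fin n → F) (y : Bin) : 0 ≤ wordWeight g κ n v y := by
  induction n generalizing y with
  | zero => exact zero_le_one
  | succ n ih =>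
    exact Finset.sum_nonneg fun b _ => mul_nonneg (mul_nonneg (hg _) (hκ _ _)) (ih _ _)

lemma prod_le_wordWeight {F : Type*} {g : Bin → ℝ} {κ : F → Bin → ℝ}
    (hg : ∀ x, 0 ≤ g x) (hκ : ∀ a x, 0 ≤ κ a x) (hgd : DependsOn g (Set.Iic 0))
    (hκd : ∀ a, DependsOn (κ a) (Set.Iic 0)) (n : ℕ) (v : Fin n → F) {y s : Bin}
    (hys : ∀ i ≤ 0, y i = s i) :
    ∏ i : Fin n, g (shift^[i + 1] s) * κ (v i) (shift^[i + 1] s) ≤ wordWeight g κ n v y := by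
  induction n generalizing y s with
  | zero => simp [wordWeight]
  | succ n ih =>
    have hagree := snoc_eq_shift_of_le hys
    have hrest := ih (Fin.tail v) hagree
    rw [Fin.prod_univ_succ, wordWeight]
    refine le_trans ?_ (Finset.single_le_sum (f := fun b => g (snoc b y) * κ (v 0) (snoc b y) *
      wordWeight g κ n (Fin.tail v) (snoc b y)) (fun b _ => mul_nonneg (mul_nonneg (hg _) (hκ _ _))
        (wordWeight_nonneg hg hκ _ _ _)) (Finset.mem_univ (s 1)))
    have e1 : g (snoc (s 1) y) = g (shift s) := hgd hagree
    have e2 : κ (v 0) (snoc (s 1) y) = κ (v 0) (shift s) := hκd _ hagree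
    simp only [e1, e2]
    exact mul_le_mul_of_nonneg_left hrest (mul_nonneg (hg _) (hκ _ _))

lemma exists_snoc_eq (y : Bin) : ∃ x, snoc (y 0) x = y := by
  refine ⟨fun i => y (i - 1), funext fun i => ?_⟩
  rcases eq_or_ne i 0 with rfl | h
  · exact snoc_zero _ _
  · rw [snoc_of_ne _ _ h]
    simp

lemma InvProb.integral_comp_iterate {μ : Measure Bin} (hμ : InvProb shift μ) (n : ℕ)
    {ψ : Bin → ℝ} (hψ : AEStronglyMeasurable ψ μ) :
    ∫ x, ψ (shift^[n] x) ∂μ = ∫ x, ψ x ∂μ := by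
  have h := hμ.2.iterate n
  rw [← integral_map h.measurable.aemeasurable (by rwa [h.map_eq]), h.map_eq]

/-- A finite-range sub-normalized transition function bounds the entropy of every observable. -/
theorem entObsT_le_integral {μ : Measure Bin} (hμ : InvProb shift μ) {g : Bin → ℝ} {r : ℕ}
    (hgd : DependsOn g (Set.Icc (-(r : ℤ)) 0)) (hpos : ∀ x, 0 < g x)
    (hsum : ∀ x, ∑ b, g (snoc b x) ≤ 1) {k : ℕ} {f : Bin → Fin k} (hf : Measurable f) :
    entObsT shift μ f ≤ ∫ x, -Real.logb 2 (g x) ∂μ := by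
  have := hμ.1
  have hk : 0 < k := (f fun _ => false).pos
  have hk' : (0 : ℝ) < k := by exact_mod_cast hk
  have hk1 : (1 : ℝ) ≤ k := by exact_mod_cast hk
  have hgc : Continuous g := continuous_of_dependsOn (Set.finite_Icc _ _) hgd
  obtain ⟨x₀, -, hx₀⟩ := isCompact_univ.exists_isMinOn ⟨fun _ => false, trivial⟩ hgc.continuousOn
  have hx₀ : ∀ x, g x₀ ≤ g x := fun x => hx₀ (Set.mem_univ x)
  have hg1 : ∀ y, g y ≤ 1 := fun y => by
    obtain ⟨x, hx⟩ := exists_snoc_eq y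
    have := Finset.single_le_sum (f := fun b => g (snoc b x)) (fun b _ => (hpos _).le)
      (Finset.mem_univ (y 0))
    simp only [hx] at this
    exact this.trans (hsum x)
  have hlg : Continuous fun x => -Real.logb 2 (g x) := by
    simp only [Real.logb]
    exact ((hgc.log fun x => (hpos x).ne').div_const _).neg
  have hlg0 : ∀ x, 0 ≤ -Real.logb 2 (g x) := fun x =>
    neg_nonneg.2 (Real.logb_nonpos one_lt_two (hpos x).le (hg1 x))
  refine le_of_forall_pos_le_add fun η hη => ?_
  set ε : ℝ := 1 - 2 ^ (-(η / 2)) with hε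
  have hpow1 : (2 : ℝ) ^ (-(η / 2)) < 1 := Real.rpow_lt_one_of_one_lt_of_neg one_lt_two (by linarith)
  have hpow0 : (0 : ℝ) < 2 ^ (-(η / 2)) := by positivity
  have hε0 : 0 < ε := by rw [hε]; linarith
  have hε1 : ε ≤ 1 := by rw [hε]; linarith
  have hlogε : -Real.logb 2 (1 - ε) = η / 2 := by
    rw [hε, sub_sub_cancel, Real.logb_rpow two_pos (by norm_num)]
    ring
  have hεk : 0 < ε / k := div_pos hε0 hk'
  set c : ℝ := -Real.logb 2 (ε / k) with hc
  have hc0 : 0 ≤ c := neg_nonneg.2 (Real.logb_nonpos one_lt_two hεk.le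
    ((div_le_one hk').2 (hε1.trans hk1)))
  obtain ⟨r', m, f', hf'd, hf'⟩ := exists_past_observable μ hf
    (show 0 < η / (2 * (c + 1)) by positivity)
  set κ : Fin k → Bin → ℝ := fun a x => (1 - ε) * (if f' x = a then 1 else 0) + ε / k with hκ
  have hκk : ∀ a x, ε / k ≤ κ a x := fun a x => by
    simp only [hκ]
    have : 0 ≤ (1 - ε) * (if f' x = a then 1 else 0) :=
      mul_nonneg (by linarith) (by split_ifs <;> norm_num)
    linarith
  have hκpos : ∀ a x, 0 < κ a x := fun a x => hεk.trans_le (hκk a x)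
  have hκsum : ∀ x, ∑ a, κ a x = 1 := fun x => by
    simp only [hκ, Finset.sum_add_distrib, ← Finset.mul_sum, Finset.sum_ite_eq, Finset.mem_univ,
      if_true, Finset.sum_const, Finset.card_univ, Fintype.card_fin, nsmul_eq_mul]
    field_simp
    ring
  set R : ℕ := max r r' with hR
  have hgR : DependsOn g (Set.Icc (-(R : ℤ)) 0) := fun x y h => hgd fun i hi => h i
    ⟨by have := hi.1; have : (r : ℤ) ≤ R := by exact_mod_cast le_max_left r r'
        omega, hi.2⟩
  have hf'R : DependsOn f' (Set.Icc (-(R : ℤ)) 0) := fun x y h => hf'd fun i hi => h i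
    ⟨by have := hi.1; have : (r' : ℤ) ≤ R := by exact_mod_cast le_max_right r r'
        omega, hi.2⟩
  have hf'c : Continuous f' := continuous_of_dependsOn (Set.finite_Icc _ _) hf'd
  have hκR : ∀ a, DependsOn (κ a) (Set.Icc (-(R : ℤ)) 0) := fun a x y h => by
    simp only [hκ, hf'R h]
  set E : Set Bin := {x | f' (shift^[m + 1] x) ≠ f x} with hE
  have hEm : MeasurableSet E := by
    have : Measurable fun x => f' (shift^[m + 1] x) :=
      hf'c.measurable.comp (measurable_shift.iterate _)
    exact (measurableSet_eq_fun this hf).compl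
  set ψ : Bin → ℝ := fun x =>
    -Real.logb 2 (g (shift^[m + 1] x)) + η / 2 + E.indicator (fun _ => c) x with hψ
  have hlgint : Integrable (fun x => -Real.logb 2 (g x)) μ :=
    hlg.integrable_of_hasCompactSupport (.of_compactSpace _)
  have hlgint' : Integrable (fun x => -Real.logb 2 (g (shift^[m + 1] x))) μ :=
    (hμ.2.iterate (m + 1)).integrable_comp_of_integrable hlgint
  have hindint : Integrable (E.indicator fun _ => c) μ := (integrable_const c).indicator hEm
  have hψint : Integrable ψ μ := (hlgint'.add (integrable_const _)).add hindint
  have hψle : ∫ x, ψ x ∂μ ≤ ∫ x, -Real.logb 2 (g x) ∂μ + η := by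
    have e1 : ∫ x, ψ x ∂μ = ∫ x, -Real.logb 2 (g x) ∂μ + η / 2 + μ.real E * c := by
      have h1 : ∫ x, ψ x ∂μ = ∫ x, (-Real.logb 2 (g (shift^[m + 1] x)) + η / 2) ∂μ
          + ∫ x, E.indicator (fun _ => c) x ∂μ :=
        integral_add (hlgint'.add (integrable_const _)) hindint
      rw [h1, integral_add hlgint' (integrable_const _),
        hμ.integral_comp_iterate (m + 1) hlgint.aestronglyMeasurable, integral_indicator hEm]
      simp
    have e2 : μ.real E * c ≤ η / 2 := by
      calc μ.real E * c ≤ η / (2 * (c + 1)) * (c + 1) :=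
            mul_le_mul hf'.le (by linarith) hc0 (by positivity)
        _ = η / 2 := by field_simp
    linarith
  have hψ0 : ∀ x, 0 ≤ ψ x := fun x => by
    have := hlg0 (shift^[m + 1] x)
    have : 0 ≤ E.indicator (fun _ => c) x := Set.indicator_nonneg (fun _ _ => hc0) x
    simp only [hψ]
    linarith
  set C : ℝ := -Real.logb 2 (g x₀) + c with hC
  have hC0 : 0 ≤ C := add_nonneg (hlg0 _) hc0
  have hterm : ∀ a z, -Real.logb 2 (g z * κ a z) = -Real.logb 2 (g z) + -Real.logb 2 (κ a z) :=
    fun a z => by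
      rw [Real.logb_mul (hpos z).ne' (hκpos a z).ne']
      ring
  have hgz : ∀ z, -Real.logb 2 (g z) ≤ -Real.logb 2 (g x₀) := fun z =>
    neg_le_neg (Real.logb_le_logb_of_le one_lt_two (hpos _) (hx₀ z))
  have hκz : ∀ a z, -Real.logb 2 (κ a z) ≤ c := fun a z =>
    neg_le_neg (Real.logb_le_logb_of_le one_lt_two hεk (hκk a z))
  have hbound : ∀ n : ℕ, entOfObs μ (fun x => fun i : Fin (n + 1) => f (shift^[(i : ℕ)] x))
      ≤ (n + 1) * ∫ x, ψ x ∂μ + R * C := by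
    intro n
    have hmeas : Measurable fun x => fun i : Fin (n + 1) => f (shift^[(i : ℕ)] x) :=
      measurable_pi_lambda _ fun i => hf.comp (measurable_shift.iterate _)
    have hiter : ∀ i : ℕ, Integrable (fun x => ψ (shift^[i] x)) μ := fun i =>
      (hμ.2.iterate i).integrable_comp_of_integrable hψint
    have hsumint : Integrable (fun x => ∑ i : Fin (n + 1), ψ (shift^[(i : ℕ)] x)) μ :=
      integrable_finsetSum _ fun i _ => hiter i
    have hwpos : ∀ (v : Fin (n + 1) → Fin k) (s : Bin),
        0 < ∏ i : Fin (n + 1), g (shift^[i + 1] s) * κ (v i) (shift^[i + 1] s) :=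
      fun v s => Finset.prod_pos fun i _ => mul_pos (hpos _) (hκpos _ _)
    have hlow := fun (v : Fin (n + 1) → Fin k) (s : Bin) (h : ∀ i ≤ 0, (fun _ : ℤ => false) i = s i) =>
      prod_le_wordWeight (fun x => (hpos x).le) (fun a x => (hκpos a x).le)
        (hgR.mono fun i hi => hi.2) (fun a => (hκR a).mono fun i hi => hi.2) (n + 1) v h
    refine (entOfObs_le_integral hmeas (q := fun v => wordWeight g κ (n + 1) v fun _ => false)
      (fun v => (hwpos v fun _ => false).trans_le (hlow v _ fun _ _ => rfl))
      (sum_wordWeight_le (fun x => (hpos x).le) hsum hκsum _ _)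
      (G := fun x => ∑ i : Fin (n + 1), ψ (shift^[(i : ℕ)] x) + R * C)
      (hsumint.add (integrable_const _)) fun x => ?_).trans_eq ?_
    · set v : Fin (n + 1) → Fin k := fun i => f (shift^[(i : ℕ)] x) with hv
      set s : Bin := fun l => if 1 ≤ l then shift^[m] x l else false with hs
      have hlog := Real.logb_le_logb_of_le one_lt_two (hwpos v s)
        (hlow v s fun i hi => by simp only [hs]; rw [if_neg (by omega)])
      rw [Real.logb_prod _ _ fun i _ => (mul_pos (hpos _) (hκpos _ _)).ne'] at hlog
      refine (neg_le_neg hlog).trans ?_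
      rw [← Finset.sum_neg_distrib]
      have hi : ∀ i : Fin (n + 1),
          -Real.logb 2 (g (shift^[i + 1] s) * κ (v i) (shift^[i + 1] s))
            ≤ ψ (shift^[(i : ℕ)] x) + if (i : ℕ) < R then C else 0 := by
        intro i
        rw [hterm]
        split_ifs with hiR
        · have h1 := hgz (shift^[(i : ℕ) + 1] s)
          have h2 := hκz (v i) (shift^[(i : ℕ) + 1] s)
          have h3 := hψ0 (shift^[(i : ℕ)] x)
          simp only [hC]
          linarith
        · have hz : ∀ l ∈ Set.Icc (-(R : ℤ)) 0,
              shift^[(i : ℕ) + 1] s l = shift^[m + 1] (shift^[(i : ℕ)] x) l := by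
            intro l hl
            have hl1 := hl.1
            rw [shift_iterate_apply, hs]
            simp only
            rw [if_pos (by push_cast; omega), shift_iterate_apply, shift_iterate_apply,
              shift_iterate_apply]
            congr 1
            push_cast
            ring
          rw [hgR hz, hκR _ hz, add_zero]
          have hκv : -Real.logb 2 (κ (v i) (shift^[m + 1] (shift^[(i : ℕ)] x)))
              ≤ η / 2 + E.indicator (fun _ => c) (shift^[(i : ℕ)] x) := by
            by_cases hxE : shift^[(i : ℕ)] x ∈ E
            · rw [Set.indicator_of_mem hxE]
              have := hκz (v i) (shift^[m + 1] (shift^[(i : ℕ)] x))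
              linarith
            · rw [Set.indicator_of_notMem hxE, add_zero, ← hlogε]
              have hεlt : 0 < 1 - ε := by rw [hε, sub_sub_cancel]; exact hpow0
              refine neg_le_neg (Real.logb_le_logb_of_le one_lt_two hεlt ?_)
              have heq : f' (shift^[m + 1] (shift^[(i : ℕ)] x)) = v i := not_not.1 hxE
              simp only [hκ, heq, if_true]
              linarith
          simp only [hψ]
          linarith
      refine (Finset.sum_le_sum fun i _ => hi i).trans ?_
      rw [Finset.sum_add_distrib]
      gcongr
      rw [Fin.sum_univ_eq_sum_range (fun i => if i < R then C else 0), ← Finset.sum_filter,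
        Finset.sum_const, nsmul_eq_mul]
      gcongr
      calc _ ≤ (Finset.range R).card := Finset.card_le_card fun i hi => by
            simpa using (Finset.mem_filter.1 hi).2
        _ = R := Finset.card_range R
    · rw [integral_add hsumint (integrable_const _), integral_finsetSum _ fun (i : Fin (n + 1)) _ => hiter i]
      simp [hμ.integral_comp_iterate _ hψint.aestronglyMeasurable]
  have hle : ∀ n : ℕ, entObsT shift μ f ≤ ∫ x, ψ x ∂μ + R * C / (n + 1) := fun n => by
    refine (entObsT_le_div shift μ f n).trans ?_
    rw [div_le_iff₀ (by positivity), add_mul, div_mul_cancel₀ _ (by positivity)]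
    linarith [hbound n]
  have hlim : Tendsto (fun n : ℕ => ∫ x, ψ x ∂μ + R * C / ((n : ℝ) + 1)) atTop
      (𝓝 (∫ x, ψ x ∂μ + 0)) := by
    refine tendsto_const_nhds.add ?_
    simpa [div_eq_mul_inv] using
      (tendsto_one_div_add_atTop_nhds_zero_nat (𝕜 := ℝ)).const_mul (R * C)
  rw [add_zero] at hlim
  exact (ge_of_tendsto' hlim hle).trans hψle

lemma entObsT_nonneg {X F : Type*} [MeasurableSpace X] [Fintype F] (T : X → X) (μ : Measure X)
    [IsProbabilityMeasure μ] (f : X → F) : 0 ≤ entObsT T μ f :=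
  Real.iInf_nonneg fun _ => div_nonneg (entOfObs_nonneg _ _) (by positivity)

lemma kolSinai_le {X : Type*} [MeasurableSpace X] (T : X → X) (μ : Measure X)
    [IsProbabilityMeasure μ] {B : ℝ}
    (h : ∀ (k : ℕ) (f : X → Fin k), Measurable f → entObsT T μ f ≤ B) : kolSinai T μ ≤ B := by
  have hB : 0 ≤ B := (entObsT_nonneg T μ _).trans (h 1 (fun _ => 0) measurable_const)
  exact Real.iSup_le (fun k => Real.iSup_le (fun f => h k f.1 f.2) hB) hB

lemma entObsT_le_one {μ : Measure Bin} (hμ : InvProb shift μ) {k : ℕ} {f : Bin → Fin k}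
    (hf : Measurable f) : entObsT shift μ f ≤ 1 := by
  have := hμ.1
  refine (entObsT_le_integral hμ (g := fun _ => 1 / 2) (r := 0) (fun _ _ _ => rfl)
    (fun _ => by norm_num) (fun _ => by norm_num) hf).trans_eq ?_
  have : Real.logb 2 (1 / 2) = -1 := by
    rw [one_div, Real.logb_inv, Real.logb_self_eq_one one_lt_two]
  simp only [this, neg_neg, integral_const, probReal_univ, smul_eq_mul, mul_one]

lemma entObsT_le_kolSinai {μ : Measure Bin} (hμ : InvProb shift μ) {k : ℕ} {f : Bin → Fin k}
    (hf : Measurable f) : entObsT shift μ f ≤ kolSinai shift μ := by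
  have h1 : ∀ k, ⨆ f : {f : Bin → Fin k // Measurable f}, entObsT shift μ f.1 ≤ 1 := fun k =>
    Real.iSup_le (fun f => entObsT_le_one hμ f.2) zero_le_one
  refine le_trans ?_ (le_ciSup (f := fun k => ⨆ f : {f : Bin → Fin k // Measurable f},
    entObsT shift μ f.1) ⟨1, by rintro _ ⟨k, rfl⟩; exact h1 k⟩ k)
  exact le_ciSup (f := fun f : {f : Bin → Fin k // Measurable f} => entObsT shift μ f.1)
    ⟨1, by rintro _ ⟨f, rfl⟩; exact entObsT_le_one hμ f.2⟩ ⟨f, hf⟩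

/-- If `w` is, up to the coboundary of `V`, a sub-normalized transition function, then the
free energy of every invariant measure with respect to `logb 2 w` is nonpositive. -/
lemma kolSinai_le_of_transfer {μ : Measure Bin} (hμ : InvProb shift μ) {w V : Bin → ℝ} {r : ℕ}
    (hw : DependsOn w (Set.Icc (-(r : ℤ)) 0)) (hV : DependsOn V (Set.Icc (-(r : ℤ)) 0))
    (hwpos : ∀ x, 0 < w x) (hVpos : ∀ x, 0 < V x)
    (hle : ∀ x, ∑ b, w (snoc b x) * V (snoc b x) ≤ V x) :
    kolSinai shift μ ≤ ∫ x, -Real.logb 2 (w x) ∂μ := by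
  have := hμ.1
  let pre : Bin → Bin := fun x i => x (i - 1)
  have hprec : Continuous pre := continuous_pi fun i => continuous_apply (i - 1)
  have hpre : ∀ b x, V (pre (snoc b x)) = V x := fun b x => hV fun i hi => by
    simp only [pre]
    rw [snoc_of_ne _ _ (by have := hi.2; omega), sub_add_cancel]
  have hlogc : ∀ {u : Bin → ℝ}, DependsOn u (Set.Icc (-(r : ℤ)) 0) → (∀ x, 0 < u x) →
      Continuous fun x => Real.logb 2 (u x) := fun hu hpos => by
    simp only [Real.logb]
    exact ((continuous_of_dependsOn (Set.finite_Icc _ _) hu).log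
      fun x => (hpos x).ne').div_const _
  have hint : ∀ {u : Bin → ℝ}, Continuous u → Integrable u μ := fun hu =>
    hu.integrable_of_hasCompactSupport (.of_compactSpace _)
  have hcob : ∫ x, Real.logb 2 (V (pre x)) ∂μ = ∫ x, Real.logb 2 (V x) ∂μ := by
    have h := hμ.integral_comp_iterate 1 (ψ := fun x => Real.logb 2 (V (pre x)))
      ((hlogc hV hVpos).comp hprec).aestronglyMeasurable
    rw [← h]
    congr! 4 with x
    funext i
    simp [pre, shift]
  have hg : ∫ x, -Real.logb 2 (w x * V x / V (pre x)) ∂μ = ∫ x, -Real.logb 2 (w x) ∂μ := by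
    have e : ∀ x, -Real.logb 2 (w x * V x / V (pre x)) =
        -Real.logb 2 (w x) + (Real.logb 2 (V (pre x)) - Real.logb 2 (V x)) := fun x => by
      rw [Real.logb_div (mul_pos (hwpos x) (hVpos x)).ne' (hVpos _).ne',
        Real.logb_mul (hwpos x).ne' (hVpos x).ne']
      ring
    simp only [e]
    have i1 := hint (hlogc hw hwpos).neg
    have i2 := hint ((hlogc hV hVpos).comp hprec)
    have i3 := hint (hlogc hV hVpos)
    have e1 := integral_add i1 (i2.sub i3)
    have e2 := integral_sub i2 i3
    simp only [Pi.neg_apply, Pi.sub_apply, Function.comp_apply] at e1 e2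
    rw [e1, e2, hcob, sub_self, add_zero]
  refine kolSinai_le _ _ fun k f hf => ?_
  rw [← hg]
  refine entObsT_le_integral (r := r + 1) hμ (fun x y h => ?_)
    (fun x => div_pos (mul_pos (hwpos x) (hVpos x)) (hVpos _)) (fun x => ?_) hf
  · have h1 : ∀ i ∈ Set.Icc (-(r : ℤ)) 0, x i = y i := fun i hi =>
      h i ⟨by have := hi.1; push_cast; omega, hi.2⟩
    have h2 : ∀ i ∈ Set.Icc (-(r : ℤ)) 0, pre x i = pre y i := fun i hi =>
      h _ ⟨by have := hi.1; push_cast; omega, by have := hi.2; omega⟩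
    rw [hw h1, hV h1, hV h2]
  · simp only [hpre]
    rw [← Finset.sum_div]
    exact (div_le_one (hVpos x)).2 (hle x)

/-! ### Periodic templates -/

/-- The symbol `b` is allowed by the template entry `o`, where `none` allows both symbols. -/
def Compat (o : Option Bool) (b : Bool) : Prop := ∀ c ∈ o, c = b

/-- The number of free bits of a template entry. -/
def bits (o : Option Bool) : ℝ := if o = none then 1 else 0

lemma bits_nonneg (o : Option Bool) : 0 ≤ bits o := by
  unfold bits; split_ifs <;> norm_num

lemma bits_le_one (o : Option Bool) : bits o ≤ 1 := by
  unfold bits; split_ifs <;> norm_num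

open Classical in
lemma sum_compat (o : Option Bool) (C : ℝ) :
    ∑ b, (if Compat o b then C else 0) = 2 ^ bits o * C := by
  rcases o with _ | (_ | _) <;> simp [Compat, bits]

/-- The last `j` symbols of the past of `x` fit the template `τ` with phase `θ` at time `0`. -/
def Fits {p : ℕ} (τ : ZMod p → Option Bool) (θ : ZMod p) (j : ℕ) (x : Bin) : Prop :=
  ∀ i : ℕ, i < j → Compat (τ (θ - i)) (x (-i))

lemma Fits.mono {p : ℕ} {τ : ZMod p → Option Bool} {θ : ZMod p} {j l : ℕ} {x : Bin}
    (h : Fits τ θ l x) (hjl : j ≤ l) : Fits τ θ j x := fun i hi => h i (hi.trans_le hjl)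

lemma fits_snoc {p : ℕ} (τ : ZMod p → Option Bool) (θ : ZMod p) (j : ℕ) (b : Bool) (x : Bin) :
    Fits τ (θ + 1) (j + 1) (snoc b x) ↔ Compat (τ (θ + 1)) b ∧ Fits τ θ j x := by
  have hs : ∀ i : ℕ, snoc b x (-((i + 1 : ℕ) : ℤ)) = x (-i) := fun i => by
    rw [snoc_of_ne _ _ (by push_cast; omega)]
    congr 1
    push_cast
    ring
  have hθ : ∀ i : ℕ, θ + 1 - ((i + 1 : ℕ) : ZMod p) = θ - i := fun i => by
    push_cast
    ring
  constructor
  · intro h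
    refine ⟨by simpa [snoc_zero] using h 0 (Nat.succ_pos j), fun i hi => ?_⟩
    have := h (i + 1) (by omega)
    rwa [hs, hθ] at this
  · rintro ⟨h0, h⟩ (_ | i) hi
    · simpa [snoc_zero] using h0
    · rw [hs, hθ]
      exact h i (by omega)

lemma dependsOn_fits {p : ℕ} (τ : ZMod p → Option Bool) (θ : ZMod p) {j r : ℕ} (hj : j ≤ r) :
    DependsOn (Fits τ θ j) (Set.Icc (-(r : ℤ)) 0) := by
  intro x y h
  refine forall_congr fun i => forall_congr fun hi => ?_
  rw [h (-i) ⟨by omega, by omega⟩]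

/-- A family of `p`-periodic templates such that a window of length `M` determines the template
and the phase. -/
structure TemplateFamily (p : ℕ) (ι : Type) where
  /-- The templates. -/
  τ : ι → ZMod p → Option Bool
  /-- The length of the recognition window. -/
  M : ℕ
  unique : ∀ (a b : ι × ZMod p) (x : Bin), Fits (τ a.1) a.2 M x → Fits (τ b.1) b.2 M x → a = b

namespace TemplateFamily

variable {p : ℕ} {ι : Type} (S : TemplateFamily p ι)

/-- The last `j` symbols of the past of `x` fit the template and phase `a`. -/
def fits (a : ι × ZMod p) (j : ℕ) (x : Bin) : Prop := Fits (S.τ a.1) a.2 j x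

lemma fits_mono {a : ι × ZMod p} {j l : ℕ} {x : Bin} (h : S.fits a l x) (hjl : j ≤ l) :
    S.fits a j x := Fits.mono h hjl

lemma not_fits_of_ne {a b : ι × ZMod p} {x : Bin} (ha : S.fits a S.M x) (hb : b ≠ a) (i : ℕ) :
    ¬ S.fits b (S.M + i) x := fun h =>
  hb (S.unique _ _ _ (S.fits_mono h (Nat.le_add_right _ _)) ha)

open Classical in
/-- The time elapsed since the template `a` was recognized, truncated at `k`. -/
def age (k : ℕ) (a : ι × ZMod p) (x : Bin) : ℕ :=
  Nat.findGreatest (fun i => S.fits a (S.M + i) x) k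

lemma dependsOn_age (k : ℕ) (a : ι × ZMod p) :
    DependsOn (S.age k a) (Set.Icc (-((S.M + k : ℕ) : ℤ)) 0) := by
  classical
  intro x y h
  induction k with
  | zero => rfl
  | succ k ih =>
    have h1 : S.fits a (S.M + (k + 1)) x = S.fits a (S.M + (k + 1)) y :=
      dependsOn_fits _ _ le_rfl h
    have h2 := ih fun i hi => h i ⟨by have := hi.1; push_cast at this ⊢; omega, hi.2⟩
    unfold age at h2 ⊢
    simp only [Nat.findGreatest_succ, h2]
    exact if_congr (iff_of_eq h1) rfl rfl

lemma age_le (k : ℕ) (a : ι × ZMod p) (x : Bin) : S.age k a x ≤ k := by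
  classical exact Nat.findGreatest_le k

lemma fits_age {k : ℕ} {a : ι × ZMod p} {x : Bin} (h : S.age k a x ≠ 0) :
    S.fits a (S.M + S.age k a x) x := by
  classical
  exact Nat.findGreatest_of_ne_zero (P := fun i => S.fits a (S.M + i) x) rfl h

lemma age_eq_zero {k : ℕ} {a : ι × ZMod p} {x : Bin} (ha : ¬ S.fits a (S.M + 1) x) :
    S.age k a x = 0 := by
  by_contra h0
  exact ha (S.fits_mono (S.fits_age h0) (by omega))

lemma fits_snoc_iff {n : ι} {θ : ZMod p} {j : ℕ} {b : Bool} {x : Bin} :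
    S.fits (n, θ + 1) (j + 1) (snoc b x) ↔ Compat (S.τ n (θ + 1)) b ∧ S.fits (n, θ) j x :=
  fits_snoc _ _ _ _ _

lemma le_age {j k : ℕ} {a : ι × ZMod p} {x : Bin} (hjk : j ≤ k) (h : S.fits a (S.M + j) x) :
    j ≤ S.age k a x := by
  classical
  exact Nat.le_findGreatest hjk h

lemma age_snoc_le {k : ℕ} {n : ι} {θ : ZMod p} {b : Bool} {x : Bin} :
    S.age k (n, θ + 1) (snoc b x) ≤ S.age k (n, θ) x + 1 := by
  rcases h0 : S.age k (n, θ + 1) (snoc b x) with _ | j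
  · exact Nat.zero_le _
  · have := S.fits_age (k := k) (a := (n, θ + 1)) (x := snoc b x) (by omega)
    rw [h0, ← add_assoc] at this
    have hk := S.age_le k (n, θ + 1) (snoc b x)
    exact Nat.succ_le_succ (S.le_age (by omega) (S.fits_snoc_iff.1 this).2)

/-- The reciprocal of the time elapsed since the template `a` was recognized, truncated. -/
def invAge (k : ℕ) (a : ι × ZMod p) (x : Bin) : ℝ := 1 / ((S.age k a x : ℝ) + 1)

/-- The reciprocal of the time elapsed since the template `a` was recognized. -/
def defect (a : ι × ZMod p) (x : Bin) : ℝ := ⨅ k, S.invAge k a x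

lemma invAge_nonneg (k : ℕ) (a : ι × ZMod p) (x : Bin) : 0 ≤ S.invAge k a x := by
  unfold invAge; positivity

lemma invAge_le_add (k l : ℕ) (a : ι × ZMod p) (x : Bin) :
    S.invAge k a x ≤ S.invAge l a x + 1 / ((k : ℝ) + 1) := by
  by_cases h : S.age l a x ≤ S.age k a x
  · have h' : (S.age l a x : ℝ) ≤ S.age k a x := by exact_mod_cast h
    have : S.invAge k a x ≤ S.invAge l a x := by unfold invAge; gcongr
    have : 0 ≤ 1 / ((k : ℝ) + 1) := by positivity
    linarith
  · have hk : k ≤ S.age k a x := by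
      by_contra hk
      have hlt : k < S.age l a x := by
        by_contra hlt
        exact h (S.le_age (not_lt.1 hlt) (S.fits_age (by omega)))
      exact hk (S.le_age le_rfl (S.fits_mono (S.fits_age (k := l) (by omega)) (by omega)))
    have h' : (k : ℝ) ≤ S.age k a x := by exact_mod_cast hk
    have : S.invAge k a x ≤ 1 / ((k : ℝ) + 1) := by unfold invAge; gcongr
    have := S.invAge_nonneg l a x
    linarith

lemma defect_nonneg (a : ι × ZMod p) (x : Bin) : 0 ≤ S.defect a x :=
  Real.iInf_nonneg fun k => S.invAge_nonneg k a x

lemma defect_le (k : ℕ) (a : ι × ZMod p) (x : Bin) : S.defect a x ≤ S.invAge k a x :=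
  ciInf_le ⟨0, by rintro _ ⟨l, rfl⟩; exact S.invAge_nonneg l a x⟩ k

lemma invAge_le_defect (k : ℕ) (a : ι × ZMod p) (x : Bin) :
    S.invAge k a x ≤ S.defect a x + 1 / ((k : ℝ) + 1) := by
  rw [← sub_le_iff_le_add]
  exact le_ciInf fun l => by have := S.invAge_le_add k l a x; linarith

lemma defect_eq_zero {a : ι × ZMod p} {x : Bin} (h : ∀ j, S.fits a j x) : S.defect a x = 0 := by
  refine le_antisymm ?_ (S.defect_nonneg a x)
  refine ge_of_tendsto' (tendsto_one_div_add_atTop_nhds_zero_nat (𝕜 := ℝ)) fun k => ?_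
  refine (S.defect_le k a x).trans_eq ?_
  rw [invAge, le_antisymm (S.age_le k a x) (S.le_age le_rfl (h _))]

lemma dependsOn_invAge (k : ℕ) (a : ι × ZMod p) :
    DependsOn (S.invAge k a) (Set.Icc (-((S.M + k : ℕ) : ℤ)) 0) := fun x y h => by
  rw [invAge, invAge, S.dependsOn_age k a h]

lemma continuous_defect (a : ι × ZMod p) : Continuous (S.defect a) := by
  have hu : TendstoUniformly (fun k => S.invAge k a) (S.defect a) atTop := by
    rw [Metric.tendstoUniformly_iff]
    intro ε hε
    filter_upwards [(tendsto_one_div_add_atTop_nhds_zero_nat (𝕜 := ℝ)).eventually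
      (gt_mem_nhds hε)] with k hk x
    rw [dist_comm, Real.dist_eq, abs_of_nonneg (sub_nonneg.2 (S.defect_le k a x))]
    have := S.invAge_le_defect k a x
    linarith
  exact hu.continuous (Frequently.of_forall fun k =>
    continuous_of_dependsOn (Set.finite_Icc _ _) (S.dependsOn_invAge k a))

open Classical in
/-- The indicator function of the recognition of `a`. -/
def ind (a : ι × ZMod p) (x : Bin) : ℝ := if S.fits a S.M x then 1 else 0

lemma dependsOn_ind (k : ℕ) (a : ι × ZMod p) :
    DependsOn (S.ind a) (Set.Icc (-((S.M + k : ℕ) : ℤ)) 0) := fun x y h => by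
  classical
  exact if_congr (iff_of_eq (dependsOn_fits _ _ (Nat.le_add_right _ _) h)) rfl rfl

lemma ind_of_fits {a : ι × ZMod p} {x : Bin} (h : S.fits a S.M x) : S.ind a x = 1 := if_pos h

lemma ind_of_not_fits {a : ι × ZMod p} {x : Bin} (h : ¬ S.fits a S.M x) : S.ind a x = 0 :=
  if_neg h

lemma continuous_ind (a : ι × ZMod p) : Continuous (S.ind a) :=
  continuous_of_dependsOn (Set.finite_Icc _ _) (S.dependsOn_ind 0 a)

variable [NeZero p] [Fintype ι]

/-- The sum of the values of `u` over the recognized templates. -/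
def recSum (u : ι × ZMod p → Bin → ℝ) (x : Bin) : ℝ := ∑ a, S.ind a x * u a x

lemma recSum_of_fits (u : ι × ZMod p → Bin → ℝ) {a : ι × ZMod p} {x : Bin}
    (h : S.fits a S.M x) : S.recSum u x = u a x := by
  rw [recSum, Finset.sum_eq_single a, S.ind_of_fits h, one_mul]
  · intro b _ hb
    rw [S.ind_of_not_fits (S.not_fits_of_ne h hb 0), zero_mul]
  · simp

lemma recSum_of_not_fits (u : ι × ZMod p → Bin → ℝ) {x : Bin}
    (h : ∀ a, ¬ S.fits a S.M x) : S.recSum u x = 0 :=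
  Finset.sum_eq_zero fun a _ => by rw [S.ind_of_not_fits (h a), zero_mul]

lemma dependsOn_recSum {u : ι × ZMod p → Bin → ℝ} {k : ℕ}
    (hu : ∀ a, DependsOn (u a) (Set.Icc (-((S.M + k : ℕ) : ℤ)) 0)) :
    DependsOn (S.recSum u) (Set.Icc (-((S.M + k : ℕ) : ℤ)) 0) := fun x y h =>
  Finset.sum_congr rfl fun a _ => by rw [S.dependsOn_ind k a h, hu a h]

/-- The potential equal to `c n` on the subshift of the template `n`, with a penalty away from
these subshifts which decays like the reciprocal of the age. -/
def pot (c : ι → ℝ) (D : ℝ) (x : Bin) : ℝ :=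
  -D + S.recSum (fun a x => c a.1 + D - D * S.defect a x) x

/-- The truncation of the potential to finitely many coordinates. -/
def potTrunc (c : ι → ℝ) (D : ℝ) (k : ℕ) (x : Bin) : ℝ :=
  -D + S.recSum (fun a x => c a.1 + D - D * S.invAge k a x) x

lemma continuous_pot (c : ι → ℝ) (D : ℝ) : Continuous (S.pot c D) :=
  continuous_const.add (continuous_finsetSum _ fun a _ =>
    (S.continuous_ind a).mul (continuous_const.sub (continuous_const.mul (S.continuous_defect a))))

lemma dependsOn_potTrunc (c : ι → ℝ) (D : ℝ) (k : ℕ) :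
    DependsOn (S.potTrunc c D k) (Set.Icc (-((S.M + k : ℕ) : ℤ)) 0) := fun x y h => by
  rw [potTrunc, potTrunc, S.dependsOn_recSum (fun a => ?_) h]
  intro x y h
  dsimp only
  rw [S.dependsOn_invAge k a h]

lemma pot_le_potTrunc (c : ι → ℝ) {D : ℝ} (hD : 0 ≤ D) (k : ℕ) (x : Bin) :
    S.pot c D x ≤ S.potTrunc c D k x + D * (1 / ((k : ℝ) + 1)) := by
  by_cases h : ∃ a, S.fits a S.M x
  · obtain ⟨a, ha⟩ := h
    rw [pot, potTrunc, S.recSum_of_fits _ ha, S.recSum_of_fits _ ha]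
    have := mul_le_mul_of_nonneg_left (S.invAge_le_defect k a x) hD
    linarith
  · rw [pot, potTrunc, S.recSum_of_not_fits _ (not_exists.1 h),
      S.recSum_of_not_fits _ (not_exists.1 h)]
    have : 0 ≤ D * (1 / ((k : ℝ) + 1)) := by positivity
    linarith

lemma pot_of_forall_fits (c : ι → ℝ) (D : ℝ) {a : ι × ZMod p} {x : Bin}
    (h : ∀ j, S.fits a j x) : S.pot c D x = c a.1 := by
  rw [pot, S.recSum_of_fits _ (h _), S.defect_eq_zero h]
  ring

lemma two_rpow_neg_div_mul_le {K m : ℝ} (hK : 9 ≤ K) (hm : 2 ≤ m) :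
    (2 : ℝ) ^ (-(K / m)) * m ≤ m - 3 / 2 := by
  have hm0 : 0 < m := by linarith
  have h1 : 1 + 6 / m ≤ (2 : ℝ) ^ (K / m) := by
    rw [Real.rpow_def_of_pos two_pos]
    have h2 : 6 / m ≤ Real.log 2 * (K / m) := by
      rw [← mul_div_assoc]
      gcongr
      nlinarith [Real.log_two_gt_d9]
    linarith [Real.add_one_le_exp (Real.log 2 * (K / m))]
  have h3 : 0 < (2 : ℝ) ^ (K / m) := by positivity
  have h4 : (2 : ℝ) ^ (K / m) * m ≥ m + 6 := by
    have := mul_le_mul_of_nonneg_right h1 hm0.le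
    rwa [add_mul, one_mul, div_mul_cancel₀ _ hm0.ne'] at this
  rw [Real.rpow_neg two_pos.le, inv_mul_le_iff₀ h3]
  have h5 : (2 : ℝ) ^ (K / m) * (m - 3 / 2) = (2 : ℝ) ^ (K / m) * m * ((m - 3 / 2) / m) := by
    field_simp
  rw [h5]
  calc m ≤ (m + 6) * ((m - 3 / 2) / m) := by
        rw [← mul_div_assoc, le_div_iff₀ hm0]
        nlinarith
    _ ≤ _ := by
        have : 0 ≤ (m - 3 / 2) / m := div_nonneg (by linarith) hm0.le
        gcongr

/-- The Lyapunov function of the potential. -/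
def lyap (ρ : ι → ZMod p → ℝ) (k : ℕ) (x : Bin) : ℝ :=
  1 + S.recSum (fun a x => 2 ^ ρ a.1 a.2 * ((S.age k a x : ℝ) + 1) - 1) x

lemma lyap_of_fits (ρ : ι → ZMod p → ℝ) (k : ℕ) {a : ι × ZMod p} {x : Bin}
    (h : S.fits a S.M x) : S.lyap ρ k x = 2 ^ ρ a.1 a.2 * ((S.age k a x : ℝ) + 1) := by
  rw [lyap, S.recSum_of_fits _ h]
  ring

lemma lyap_of_not_fits (ρ : ι → ZMod p → ℝ) (k : ℕ) {x : Bin} (h : ∀ a, ¬ S.fits a S.M x) :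
    S.lyap ρ k x = 1 := by
  rw [lyap, S.recSum_of_not_fits _ h, add_zero]

lemma lyap_pos (ρ : ι → ZMod p → ℝ) (k : ℕ) (x : Bin) : 0 < S.lyap ρ k x := by
  by_cases h : ∃ a, S.fits a S.M x
  · obtain ⟨a, ha⟩ := h
    rw [S.lyap_of_fits ρ k ha]
    positivity
  · rw [S.lyap_of_not_fits ρ k (not_exists.1 h)]
    exact one_pos

lemma dependsOn_lyap (ρ : ι → ZMod p → ℝ) (k : ℕ) :
    DependsOn (S.lyap ρ k) (Set.Icc (-((S.M + k : ℕ) : ℤ)) 0) := fun x y h => by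
  rw [lyap, lyap, S.dependsOn_recSum (fun a => ?_) h]
  intro x y h
  dsimp only
  rw [S.dependsOn_age k a h]

/-- The weight function of the truncated potential at inverse temperature `t`, normalized by the
pressure `L`. -/
def weight (c : ι → ℝ) (D t L : ℝ) (k : ℕ) (x : Bin) : ℝ := 2 ^ (t * S.potTrunc c D k x - L)

variable {c : ι → ℝ} {D t L : ℝ} {h : ι → ℝ} {ρ : ι → ZMod p → ℝ} {k : ℕ}

lemma weight_mul_lyap_le_of_not_fits (hh : ∀ n, 0 ≤ h n) (hL0 : 0 ≤ L)
    (hL : ∀ n, h n + t * c n ≤ L) (hρ : ∀ n θ, |ρ n θ| ≤ p) {y : Bin}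
    (hy : ∀ a, ¬ S.fits a (S.M + 1) y) :
    S.weight c D t L k y * S.lyap ρ k y ≤ 2 ^ (p - t * D) := by
  have hp : (0 : ℝ) ≤ p := Nat.cast_nonneg p
  by_cases hf : ∃ a, S.fits a S.M y
  · obtain ⟨a, ha⟩ := hf
    rw [S.lyap_of_fits ρ k ha, weight, potTrunc, S.recSum_of_fits _ ha, invAge,
      S.age_eq_zero (hy a), Nat.cast_zero, zero_add, mul_one, ← Real.rpow_add two_pos]
    refine Real.rpow_le_rpow_of_exponent_le one_le_two ?_
    have := hL a.1
    have := hh a.1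
    have := (abs_le.1 (hρ a.1 a.2)).2
    linarith
  · rw [S.lyap_of_not_fits ρ k (not_exists.1 hf), weight, potTrunc,
      S.recSum_of_not_fits _ (not_exists.1 hf), mul_one]
    refine Real.rpow_le_rpow_of_exponent_le one_le_two ?_
    linarith

lemma weight_mul_lyap_le_of_fits (hL : ∀ n, h n + t * c n ≤ L) (hD : 2 * p + 9 ≤ t * D)
    {n : ι} {θ : ZMod p} {b : Bool} {x : Bin}
    (hy : S.fits (n, θ + 1) (S.M + 1) (snoc b x)) :
    S.weight c D t L k (snoc b x) * S.lyap ρ k (snoc b x) ≤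
      2 ^ (ρ n (θ + 1) - h n) * ((S.age k (n, θ) x : ℝ) + 1 / 2) := by
  have hp : (0 : ℝ) ≤ p := Nat.cast_nonneg p
  have ha := S.fits_mono hy (Nat.le_add_right _ 1)
  have hle : (S.age k (n, θ + 1) (snoc b x) : ℝ) ≤ S.age k (n, θ) x + 1 := by
    exact_mod_cast S.age_snoc_le
  rw [S.lyap_of_fits ρ k ha, weight, potTrunc, S.recSum_of_fits _ ha, invAge]
  set m : ℝ := (S.age k (n, θ + 1) (snoc b x) : ℝ) + 1 with hm
  have hm0 : 0 < m := by positivity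
  have key : (2 : ℝ) ^ (-(t * D / m)) * m ≤ (S.age k (n, θ) x : ℝ) + 1 / 2 := by
    rcases Nat.eq_zero_or_pos (S.age k (n, θ + 1) (snoc b x)) with h0 | h0
    · have hm1 : m = 1 := by rw [hm, h0]; simp
      rw [hm1, mul_one, div_one]
      have h1 : (2 : ℝ) ^ (-(t * D)) ≤ 2 ^ (-1 : ℝ) :=
        Real.rpow_le_rpow_of_exponent_le one_le_two (by linarith)
      have h2 : (2 : ℝ) ^ (-1 : ℝ) = 1 / 2 := by
        rw [Real.rpow_neg_one]; norm_num
      have h3 : (0 : ℝ) ≤ S.age k (n, θ) x := Nat.cast_nonneg _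
      linarith [h1.trans_eq h2]
    · have h1 : (1 : ℝ) ≤ S.age k (n, θ + 1) (snoc b x) := by exact_mod_cast h0
      have := two_rpow_neg_div_mul_le (K := t * D) (m := m) (by linarith) (by linarith)
      linarith
  calc _ = 2 ^ (ρ n (θ + 1) + t * c n - L) * ((2 : ℝ) ^ (-(t * D / m)) * m) := by
        rw [← mul_assoc, ← mul_assoc, ← Real.rpow_add two_pos, ← Real.rpow_add two_pos]
        congr 2
        ring
    _ ≤ 2 ^ (ρ n (θ + 1) - h n) * ((S.age k (n, θ) x : ℝ) + 1 / 2) := by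
        refine mul_le_mul (Real.rpow_le_rpow_of_exponent_le one_le_two ?_) key (by positivity)
          (by positivity)
        have := hL n
        linarith

lemma transfer_le (hh : ∀ n, 0 ≤ h n) (hL0 : 0 ≤ L) (hL : ∀ n, h n + t * c n ≤ L)
    (hD : 2 * p + 9 ≤ t * D) (hρ : ∀ n θ, |ρ n θ| ≤ p)
    (hstep : ∀ n θ, ρ n (θ + 1) = ρ n θ + h n - bits (S.τ n (θ + 1))) (x : Bin) :
    ∑ b, S.weight c D t L k (snoc b x) * S.lyap ρ k (snoc b x) ≤ S.lyap ρ k x := by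
  classical
  have hp : (0 : ℝ) ≤ p := Nat.cast_nonneg p
  by_cases hf : ∃ a, S.fits a S.M x
  · obtain ⟨⟨n, θ⟩, ha⟩ := hf
    rw [S.lyap_of_fits ρ k ha]
    set A : ℝ := (S.age k (n, θ) x : ℝ)
    have hA0 : 0 ≤ A := Nat.cast_nonneg _
    have hb : ∀ b, S.weight c D t L k (snoc b x) * S.lyap ρ k (snoc b x) ≤ 2 ^ (p - t * D) +
        if Compat (S.τ n (θ + 1)) b then 2 ^ (ρ n (θ + 1) - h n) * (A + 1 / 2) else 0 := by
      intro b
      by_cases hy : ∃ a, S.fits a (S.M + 1) (snoc b x)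
      · obtain ⟨⟨n', θ'⟩, hy⟩ := hy
        obtain ⟨θ', rfl⟩ : ∃ θ'', θ' = θ'' + 1 := ⟨θ' - 1, (sub_add_cancel _ _).symm⟩
        have h1 := S.fits_snoc_iff.1 hy
        have h2 := S.unique _ _ _ h1.2 ha
        obtain ⟨rfl, rfl⟩ := Prod.mk.inj h2
        rw [if_pos h1.1]
        have := S.weight_mul_lyap_le_of_fits (k := k) (ρ := ρ) hL hD hy
        have h3 : (0 : ℝ) < 2 ^ (p - t * D) := by positivity
        linarith
      · have h1 := S.weight_mul_lyap_le_of_not_fits (k := k) (D := D) hh hL0 hL hρ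
          (not_exists.1 hy)
        have h2 : (0 : ℝ) ≤ if Compat (S.τ n (θ + 1)) b then
            2 ^ (ρ n (θ + 1) - h n) * (A + 1 / 2) else 0 := by
          split_ifs <;> positivity
        linarith
    refine (Finset.sum_le_sum fun b _ => hb b).trans ?_
    rw [Finset.sum_add_distrib, sum_compat, ← mul_assoc, ← Real.rpow_add two_pos, hstep]
    have e1 : bits (S.τ n (θ + 1)) + (ρ n θ + h n - bits (S.τ n (θ + 1)) - h n) = ρ n θ := by
      ring
    have e2 : (2 : ℝ) ^ (p - t * D) * 4 ≤ 2 ^ ρ n θ := by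
      have h4 : (4 : ℝ) = 2 ^ (2 : ℝ) := by norm_num
      rw [h4, ← Real.rpow_add two_pos]
      refine Real.rpow_le_rpow_of_exponent_le one_le_two ?_
      have := (abs_le.1 (hρ n θ)).1
      linarith
    rw [e1]
    simp only [Finset.sum_const, Finset.card_univ, Fintype.card_bool, nsmul_eq_mul]
    push_cast
    linarith
  · have hf' := not_exists.1 hf
    rw [S.lyap_of_not_fits ρ k hf']
    have hb : ∀ b, S.weight c D t L k (snoc b x) * S.lyap ρ k (snoc b x) ≤ 2 ^ (p - t * D) := by
      refine fun b => S.weight_mul_lyap_le_of_not_fits hh hL0 hL hρ fun a ha => ?_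
      obtain ⟨n', θ'⟩ := a
      obtain ⟨θ', rfl⟩ : ∃ θ'', θ' = θ'' + 1 := ⟨θ' - 1, (sub_add_cancel _ _).symm⟩
      exact hf' _ (S.fits_snoc_iff.1 ha).2
    refine (Finset.sum_le_sum fun b _ => hb b).trans ?_
    have e2 : (2 : ℝ) ^ (p - t * D) ≤ 2 ^ (-1 : ℝ) :=
      Real.rpow_le_rpow_of_exponent_le one_le_two (by linarith)
    have h2 : (2 : ℝ) ^ (-1 : ℝ) = 1 / 2 := by
      rw [Real.rpow_neg_one]; norm_num
    simp only [Finset.sum_const, Finset.card_univ, Fintype.card_bool, nsmul_eq_mul]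
    push_cast
    linarith [e2.trans_eq h2]

/-- The free energy of every invariant measure is at most the maximum of the free energies of
the templates. -/
theorem kolSinai_add_integral_le {μ : Measure Bin} (hμ : InvProb shift μ) (ht : 0 ≤ t)
    (hD0 : 0 ≤ D) (hh : ∀ n, 0 ≤ h n) (hL0 : 0 ≤ L) (hL : ∀ n, h n + t * c n ≤ L)
    (hD : 2 * p + 9 ≤ t * D) (hρ : ∀ n θ, |ρ n θ| ≤ p)
    (hstep : ∀ n θ, ρ n (θ + 1) = ρ n θ + h n - bits (S.τ n (θ + 1))) :
    kolSinai shift μ + ∫ x, t * S.pot c D x ∂μ ≤ L := by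
  have := hμ.1
  have hint : ∀ {u : Bin → ℝ}, Continuous u → Integrable u μ := fun hu =>
    hu.integrable_of_hasCompactSupport (.of_compactSpace _)
  have hk : ∀ k : ℕ, kolSinai shift μ + ∫ x, t * S.pot c D x ∂μ ≤
      L + t * D * (1 / ((k : ℝ) + 1)) := by
    intro k
    have hw : DependsOn (S.weight c D t L k) (Set.Icc (-((S.M + k : ℕ) : ℤ)) 0) :=
      fun x y hxy => by rw [weight, weight, S.dependsOn_potTrunc c D k hxy]
    have h1 := kolSinai_le_of_transfer hμ hw (S.dependsOn_lyap ρ k)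
      (fun x => Real.rpow_pos_of_pos two_pos _) (S.lyap_pos ρ k)
      (S.transfer_le hh hL0 hL hD hρ hstep)
    have hc : Continuous (S.potTrunc c D k) :=
      continuous_of_dependsOn (Set.finite_Icc _ _) (S.dependsOn_potTrunc c D k)
    have h2 : ∀ x, -Real.logb 2 (S.weight c D t L k x) = L - t * S.potTrunc c D k x := fun x => by
      rw [weight, Real.logb_rpow two_pos (by norm_num)]
      ring
    simp only [h2] at h1
    rw [integral_sub (integrable_const _) (hint (hc.const_mul t)), integral_const, probReal_univ,
      one_smul] at h1
    have h3 : ∫ x, t * S.pot c D x ∂μ ≤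
        ∫ x, (t * S.potTrunc c D k x + t * D * (1 / ((k : ℝ) + 1))) ∂μ := by
      refine integral_mono (hint ((S.continuous_pot c D).const_mul t))
        (hint ((hc.const_mul t).add continuous_const)) fun x => ?_
      have := mul_le_mul_of_nonneg_left (S.pot_le_potTrunc c hD0 k x) ht
      dsimp only
      linarith
    rw [integral_add (hint (hc.const_mul t)) (integrable_const _), integral_const, probReal_univ,
      one_smul] at h3
    linarith
  have hlim := ((tendsto_one_div_add_atTop_nhds_zero_nat (𝕜 := ℝ)).const_mul (t * D)).const_add L
  rw [mul_zero, add_zero] at hlim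
  exact ge_of_tendsto' hlim hk

end TemplateFamily

/-! ### The measures carried by the templates -/

/-- The fair coin tossing measure. -/
def coin : Measure Bin := Measure.infinitePi fun _ : ℤ => (PMF.uniformOfFintype Bool).toMeasure

instance : IsProbabilityMeasure coin := by unfold coin; infer_instance

lemma coin_pi_singleton (s : Finset ℤ) (c : Bin) :
    coin (Set.pi s fun i => {c i}) = (2 : ENNReal)⁻¹ ^ s.card := by
  rw [coin, Measure.infinitePi_pi _ fun i _ => measurableSet_singleton _]
  simp

lemma map_shift_coin : coin.map shift = coin := by
  refine Measure.eq_infinitePi _ fun s t ht => ?_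
  have e : shift ⁻¹' Set.pi s t =
      Set.pi (s.map (Equiv.addRight (1 : ℤ)).toEmbedding : Finset ℤ) fun i => t (i - 1) := by
    ext x
    simp only [Set.mem_preimage, Set.mem_pi, Finset.mem_coe, Finset.forall_mem_map,
      Equiv.coe_toEmbedding, Equiv.coe_addRight, shift, add_sub_cancel_right]
  rw [Measure.map_apply measurable_shift (.pi s.countable_toSet fun i _ => ht i), e, coin,
    Measure.infinitePi_pi _ fun i _ => ht _, Finset.prod_map]
  simp

lemma InvProb.of_average {p : ℕ} [NeZero p] {ν : ZMod p → Measure Bin}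
    (h1 : ∀ θ, IsProbabilityMeasure (ν θ)) (hν : ∀ θ, (ν θ).map shift = ν (θ + 1)) :
    InvProb shift ((p : ENNReal)⁻¹ • ∑ θ, ν θ) := by
  have hp : (p : ENNReal) ≠ 0 := by exact_mod_cast NeZero.ne p
  refine ⟨⟨?_⟩, measurable_shift, ?_⟩
  · rw [Measure.smul_apply, Measure.finsetSum_apply]
    simp [ZMod.card, ENNReal.inv_mul_cancel hp]
  · rw [Measure.map_smul, ← Measure.mapₗ_apply_of_measurable measurable_shift, map_sum]
    simp only [Measure.mapₗ_apply_of_measurable measurable_shift, hν]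
    exact congrArg _ (Equiv.sum_comp (Equiv.addRight (1 : ZMod p)) ν)

lemma le_entOfObs_of_average {X F Θ : Type*} [MeasurableSpace X] [Fintype F]
    [MeasurableSpace F] [MeasurableSingletonClass F] [Fintype Θ] [Nonempty Θ] {ν : Θ → Measure X}
    (h1 : ∀ θ, IsProbabilityMeasure (ν θ)) {f : X → F} (hf : Measurable f) {B : Θ → ℝ}
    (hB : ∀ θ a, (ν θ (f ⁻¹' {a})).toReal ≤ 2 ^ (-B θ)) :
    (∑ θ, B θ) / Fintype.card Θ ≤
      entOfObs ((Fintype.card Θ : ENNReal)⁻¹ • ∑ θ, ν θ) f := by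
  have hl : 0 < Real.log 2 := Real.log_pos one_lt_two
  have hc : (0 : ℝ) < Fintype.card Θ := by exact_mod_cast Fintype.card_pos
  have hconc : ∀ q : Θ → ℝ, (∀ θ, 0 ≤ q θ) →
      ∑ θ, (Fintype.card Θ : ℝ)⁻¹ * -(q θ * Real.logb 2 (q θ)) ≤
        -((∑ θ, (Fintype.card Θ : ℝ)⁻¹ * q θ) *
          Real.logb 2 (∑ θ, (Fintype.card Θ : ℝ)⁻¹ * q θ)) := by
    intro q hq
    have e : ∀ x : ℝ, -(x * Real.logb 2 x) = Real.negMulLog x / Real.log 2 := fun x => by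
      rw [Real.negMulLog, Real.logb]; ring
    have := Real.concaveOn_negMulLog.le_map_sum (t := Finset.univ)
      (w := fun _ : Θ => (Fintype.card Θ : ℝ)⁻¹) (p := q) (fun _ _ => by positivity)
      (by simp) (fun θ _ => hq θ)
    simp only [smul_eq_mul] at this
    simp only [e, ← mul_div_assoc]
    rw [← Finset.sum_div]
    gcongr
  have hsum : ∀ θ, ∑ a, (ν θ (f ⁻¹' {a})).toReal = 1 := fun θ => by
    have := h1 θ
    have := sum_measureReal_preimage_singleton (μ := ν θ) Finset.univ (f := f)
      fun a _ => hf (measurableSet_singleton a)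
    simpa [Measure.real] using this
  have hent : ∀ θ, B θ ≤ ∑ a, -((ν θ (f ⁻¹' {a})).toReal *
      Real.logb 2 (ν θ (f ⁻¹' {a})).toReal) := by
    intro θ
    calc B θ = ∑ a, (ν θ (f ⁻¹' {a})).toReal * B θ := by rw [← Finset.sum_mul, hsum, one_mul]
      _ ≤ _ := by
        refine Finset.sum_le_sum fun a _ => ?_
        rw [← mul_neg]
        rcases (ENNReal.toReal_nonneg (a := ν θ (f ⁻¹' {a}))).eq_or_lt with h0 | h0
        · rw [← h0, zero_mul, zero_mul]
        · refine mul_le_mul_of_nonneg_left ?_ h0.le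
          rw [le_neg, ← Real.logb_rpow (b := 2) (x := -B θ) two_pos (by norm_num)]
          exact Real.logb_le_logb_of_le one_lt_two h0 (hB θ a)
  have hreal : ∀ a, ((((Fintype.card Θ : ENNReal)⁻¹ • ∑ θ, ν θ) (f ⁻¹' {a})).toReal) =
      ∑ θ, (Fintype.card Θ : ℝ)⁻¹ * (ν θ (f ⁻¹' {a})).toReal := fun a => by
    rw [Measure.smul_apply, Measure.finsetSum_apply, smul_eq_mul, ENNReal.toReal_mul,
      ENNReal.toReal_sum (fun θ _ => by have := h1 θ; exact measure_ne_top _ _), Finset.mul_sum]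
    simp
  calc (∑ θ, B θ) / Fintype.card Θ = ∑ θ, (Fintype.card Θ : ℝ)⁻¹ * B θ := by
        rw [← Finset.mul_sum, div_eq_inv_mul]
    _ ≤ ∑ θ, (Fintype.card Θ : ℝ)⁻¹ * ∑ a, -((ν θ (f ⁻¹' {a})).toReal *
      Real.logb 2 (ν θ (f ⁻¹' {a})).toReal) := by
        gcongr with θ
        exact hent θ
    _ = ∑ a, ∑ θ, (Fintype.card Θ : ℝ)⁻¹ * -((ν θ (f ⁻¹' {a})).toReal *
      Real.logb 2 (ν θ (f ⁻¹' {a})).toReal) := by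
        simp only [Finset.mul_sum]
        exact Finset.sum_comm
    _ ≤ _ := by
        unfold entOfObs
        refine Finset.sum_le_sum fun a _ => ?_
        rw [hreal]
        exact hconc _ fun θ => ENNReal.toReal_nonneg

/-- The free positions of the template `τ` with phase `θ` are filled by the symbols of `b`. -/
def fill {p : ℕ} (τ : ZMod p → Option Bool) (θ : ZMod p) (b : Bin) : Bin := fun i =>
  (τ (θ + i)).getD (b i)

lemma shift_fill {p : ℕ} (τ : ZMod p → Option Bool) (θ : ZMod p) (b : Bin) :
    shift (fill τ θ b) = fill τ (θ + 1) (shift b) := by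
  funext i
  simp only [shift, fill]
  push_cast
  rw [add_assoc, add_comm (i : ZMod p)]

lemma continuous_fill {p : ℕ} (τ : ZMod p → Option Bool) (θ : ZMod p) :
    Continuous (fill τ θ) :=
  continuous_pi fun i => (continuous_of_discreteTopology (f := (τ (θ + i)).getD)).comp
    (continuous_apply i)

lemma fits_fill {p : ℕ} (τ : ZMod p → Option Bool) (θ : ZMod p) (j : ℕ) (b : Bin) :
    Fits τ θ j (fill τ θ b) := by
  intro i _ c hc
  simp only [fill]
  push_cast
  rw [← sub_eq_add_neg, Option.mem_def.1 hc, Option.getD_some]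

/-- The distribution of the random filling of the template `τ` with phase `θ`. -/
def phaseMeasure {p : ℕ} (τ : ZMod p → Option Bool) (θ : ZMod p) : Measure Bin :=
  coin.map (fill τ θ)

instance {p : ℕ} (τ : ZMod p → Option Bool) (θ : ZMod p) :
    IsProbabilityMeasure (phaseMeasure τ θ) :=
  Measure.isProbabilityMeasure_map (continuous_fill τ θ).measurable.aemeasurable

/-- The stationary random filling of the template `τ`. -/
def templateMeasure {p : ℕ} [NeZero p] (τ : ZMod p → Option Bool) : Measure Bin :=
  (p : ENNReal)⁻¹ • ∑ θ, phaseMeasure τ θ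

lemma invProb_templateMeasure {p : ℕ} [NeZero p] (τ : ZMod p → Option Bool) :
    InvProb shift (templateMeasure τ) := by
  refine InvProb.of_average (fun θ => inferInstance) fun θ => ?_
  rw [phaseMeasure, phaseMeasure, Measure.map_map measurable_shift (continuous_fill _ _).measurable]
  conv_rhs => rw [← map_shift_coin]
  rw [Measure.map_map (continuous_fill _ _).measurable measurable_shift]
  congr 1
  funext b
  exact shift_fill τ θ b

lemma integral_templateMeasure {p : ℕ} [NeZero p] (τ : ZMod p → Option Bool) {ψ : Bin → ℝ}
    (hψ : Continuous ψ) {C : ℝ} (hC : ∀ θ b, ψ (fill τ θ b) = C) :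
    ∫ x, ψ x ∂(templateMeasure τ) = C := by
  have hp : (p : ℝ) ≠ 0 := by exact_mod_cast NeZero.ne p
  have h : ∀ θ, ∫ x, ψ x ∂(phaseMeasure τ θ) = C := fun θ => by
    rw [phaseMeasure, integral_map (continuous_fill _ _).measurable.aemeasurable
      hψ.aestronglyMeasurable]
    simp [hC]
  rw [templateMeasure, integral_smul_measure, integral_finsetSum_measure fun θ _ =>
    hψ.integrable_of_hasCompactSupport (.of_compactSpace _)]
  simp [h, ZMod.card, hp]

lemma phaseMeasure_word_le {p : ℕ} (τ : ZMod p → Option Bool) (θ : ZMod p) (n : ℕ)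
    {f : Bin → Fin 2} (hf : Measurable f) (hf0 : ∀ x y, f x = f y → x 0 = y 0)
    (a : Fin n → Fin 2) :
    (phaseMeasure τ θ ((fun x => fun i : Fin n => f (shift^[(i : ℕ)] x)) ⁻¹' {a})).toReal ≤
      2 ^ (-∑ i : Fin n, bits (τ (θ + (i : ℕ)))) := by
  classical
  have hm : Measurable fun x => fun i : Fin n => f (shift^[(i : ℕ)] x) :=
    measurable_pi_lambda _ fun i => hf.comp (measurable_shift.iterate _)
  rw [phaseMeasure, Measure.map_apply (continuous_fill _ _).measurable
    (hm (measurableSet_singleton a))]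
  set A := fill τ θ ⁻¹' ((fun x => fun i : Fin n => f (shift^[(i : ℕ)] x)) ⁻¹' {a})
  rcases A.eq_empty_or_nonempty with hA | ⟨b₀, hb₀⟩
  · rw [hA]
    simp only [measure_empty, ENNReal.toReal_zero]
    positivity
  · let J : Finset (Fin n) := Finset.univ.filter fun i => τ (θ + (i : ℕ)) = none
    let e : Fin n ↪ ℤ := ⟨fun i => ((i : ℕ) : ℤ), fun i j h => by
      simpa [Fin.ext_iff] using h⟩
    have hsub : A ⊆ Set.pi (J.map e : Finset ℤ) fun i => {b₀ i} := by
      intro b hb i hi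
      obtain ⟨j, hj, rfl⟩ := Finset.mem_map.1 (Finset.mem_coe.1 hi)
      have hj' : τ (θ + (j : ℕ)) = none := (Finset.mem_filter.1 hj).2
      have h1 : f (shift^[(j : ℕ)] (fill τ θ b)) = f (shift^[(j : ℕ)] (fill τ θ b₀)) :=
        (congrFun (Set.mem_singleton_iff.1 hb) j).trans
          (congrFun (Set.mem_singleton_iff.1 hb₀) j).symm
      have h2 := hf0 _ _ h1
      simp only [shift_iterate_apply, fill, zero_add, Int.cast_natCast, hj',
        Option.getD_none] at h2
      exact h2
    have hB : ∑ i : Fin n, bits (τ (θ + (i : ℕ))) = J.card := by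
      simp [bits, J]
    calc (coin A).toReal ≤ (coin (Set.pi (J.map e : Finset ℤ) fun i => {b₀ i})).toReal :=
          ENNReal.toReal_mono (measure_ne_top _ _) (measure_mono hsub)
      _ = _ := by
          rw [coin_pi_singleton, hB, Finset.card_map, Real.rpow_neg two_pos.le,
            Real.rpow_natCast]
          simp

/-- The entropy of the random filling of a template is at least its density of free bits. -/
lemma le_kolSinai_templateMeasure {p : ℕ} [NeZero p] (τ : ZMod p → Option Bool) {h : ℝ}
    (hh : ∑ θ, bits (τ θ) = p * h) : h ≤ kolSinai shift (templateMeasure τ) := by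
  let f : Bin → Fin 2 := fun x => if x 0 then 1 else 0
  have hf : Measurable f := (Measurable.of_discrete (f := fun b : Bool => if b then (1 : Fin 2)
    else 0)).comp (measurable_pi_apply 0)
  have hf0 : ∀ x y, f x = f y → x 0 = y 0 := by
    intro x y
    simp only [f]
    cases x 0 <;> cases y 0 <;> simp
  have hp : (0 : ℝ) < p := by exact_mod_cast NeZero.pos p
  refine le_trans (le_ciInf fun n => ?_) (entObsT_le_kolSinai (invProb_templateMeasure τ) hf)
  have hm : Measurable fun x => fun i : Fin (n + 1) => f (shift^[(i : ℕ)] x) :=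
    measurable_pi_lambda _ fun i => hf.comp (measurable_shift.iterate _)
  have := le_entOfObs_of_average (ν := phaseMeasure τ) (fun θ => inferInstance) hm
    (fun θ a => phaseMeasure_word_le τ θ (n + 1) hf hf0 a)
  rw [ZMod.card] at this
  refine le_trans (le_of_eq ?_) (div_le_div_of_nonneg_right this (by positivity))
  rw [Finset.sum_comm]
  have : ∀ i : Fin (n + 1), ∑ θ, bits (τ (θ + (i : ℕ))) = p * h := fun i => by
    rw [← hh]
    exact Equiv.sum_comp (Equiv.addRight ((i : ℕ) : ZMod p)) fun θ => bits (τ θ)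
  simp only [this]
  simp
  field_simp

/-! ### The pressure of the template potentials -/

lemma sum_zmod_eq_sum_range {p : ℕ} [NeZero p] (F : ZMod p → ℝ) :
    ∑ θ, F θ = ∑ i ∈ Finset.range p, F i :=
  Finset.sum_nbij' ZMod.val (fun i => (i : ZMod p))
    (fun θ _ => Finset.mem_range.2 (ZMod.val_lt θ)) (fun _ _ => Finset.mem_univ _)
    (fun θ _ => ZMod.natCast_zmod_val θ)
    (fun i hi => ZMod.val_natCast_of_lt (Finset.mem_range.1 hi))
    (fun θ _ => by rw [ZMod.natCast_zmod_val])

/-- A function on a cycle with zero mean is the increment of a bounded function. -/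
lemma exists_increment {p : ℕ} [NeZero p] {f : ZMod p → ℝ} (h0 : ∑ θ, f θ = 0)
    (h1 : ∀ θ, |f θ| ≤ 1) :
    ∃ ρ : ZMod p → ℝ, (∀ θ, |ρ θ| ≤ p) ∧ ∀ θ, ρ (θ + 1) = ρ θ + f (θ + 1) := by
  refine ⟨fun θ => ∑ i ∈ Finset.range (θ.val + 1), f i, fun θ => ?_, fun θ => ?_⟩
  · calc |∑ i ∈ Finset.range (θ.val + 1), f i|
        ≤ ∑ i ∈ Finset.range (θ.val + 1), |f i| := Finset.abs_sum_le_sum_abs _ _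
      _ ≤ ∑ i ∈ Finset.range (θ.val + 1), 1 := Finset.sum_le_sum fun i _ => h1 _
      _ = ((θ.val + 1 : ℕ) : ℝ) := by simp
      _ ≤ p := by exact_mod_cast ZMod.val_lt θ
  · have hθ : θ + 1 = ((θ.val + 1 : ℕ) : ZMod p) := by
      push_cast
      rw [ZMod.natCast_zmod_val]
    have hv : (θ + 1).val = (θ.val + 1) % p := by rw [hθ, ZMod.val_natCast]
    dsimp only
    rcases (Nat.succ_le_of_lt (ZMod.val_lt θ)).eq_or_lt with h | h
    · rw [Nat.succ_eq_add_one] at h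
      rw [sum_zmod_eq_sum_range] at h0
      rw [hv, hθ, h, Nat.mod_self, h0]
      simp
    · rw [hv, Nat.mod_eq_of_lt h, Finset.sum_range_succ _ (θ.val + 1), ← hθ]

namespace TemplateFamily

/-- The pressure of the potential is the maximum of the free energies of the templates. -/
theorem pressure_pot {p : ℕ} [NeZero p] {ι : Type} [Fintype ι] (S : TemplateFamily p ι)
    {c h : ι → ℝ} {D t L : ℝ} (ht : 0 ≤ t) (hD0 : 0 ≤ D) (hD : 2 * p + 9 ≤ t * D)
    (hh : ∀ n, ∑ θ, bits (S.τ n θ) = p * h n) (hL0 : 0 ≤ L) (hL : ∀ n, h n + t * c n ≤ L)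
    (hLm : ∃ n, h n + t * c n = L) :
    pressure shift (fun x => t * S.pot c D x) = L := by
  have hp : (0 : ℝ) < p := by exact_mod_cast NeZero.pos p
  have hh0 : ∀ n, 0 ≤ h n := fun n => by
    have : 0 ≤ p * h n := hh n ▸ Finset.sum_nonneg fun θ _ => bits_nonneg _
    exact nonneg_of_mul_nonneg_right this hp
  have hh1 : ∀ n, h n ≤ 1 := fun n => by
    have : p * h n ≤ ∑ θ : ZMod p, 1 := hh n ▸ Finset.sum_le_sum fun θ _ => bits_le_one _
    simp only [Finset.sum_const, Finset.card_univ, ZMod.card, nsmul_eq_mul] at this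
    exact le_of_mul_le_mul_left this hp
  have hρ : ∀ n, ∃ ρ : ZMod p → ℝ, (∀ θ, |ρ θ| ≤ p) ∧
      ∀ θ, ρ (θ + 1) = ρ θ + (h n - bits (S.τ n (θ + 1))) := fun n =>
    exists_increment (f := fun θ => h n - bits (S.τ n θ))
      (by simp [Finset.sum_sub_distrib, hh n, ZMod.card]) fun θ => by
        rw [abs_le]
        constructor <;> linarith [hh0 n, hh1 n, bits_nonneg (S.τ n θ), bits_le_one (S.τ n θ)]
  choose ρ hρ1 hρ2 using hρ
  have hub : ∀ μ : {μ : Measure Bin // InvProb shift μ},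
      kolSinai shift μ.1 + ∫ x, t * S.pot c D x ∂μ.1 ≤ L := fun μ =>
    S.kolSinai_add_integral_le μ.2 ht hD0 hh0 hL0 hL hD hρ1 fun n θ => by
      rw [hρ2]
      ring
  obtain ⟨n, hn⟩ := hLm
  have : Nonempty {μ : Measure Bin // InvProb shift μ} :=
    ⟨⟨_, invProb_templateMeasure (S.τ n)⟩⟩
  refine le_antisymm (ciSup_le hub) ?_
  refine le_trans ?_ (le_ciSup (f := fun μ : {μ : Measure Bin // InvProb shift μ} =>
    kolSinai shift μ.1 + ∫ x, t * S.pot c D x ∂μ.1) ⟨L, by rintro _ ⟨μ, rfl⟩; exact hub μ⟩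
    ⟨_, invProb_templateMeasure (S.τ n)⟩)
  dsimp only
  rw [integral_templateMeasure (S.τ n) ((S.continuous_pot c D).const_mul t) (C := t * c n)
    fun θ b => by rw [S.pot_of_forall_fits c D (a := (n, θ)) fun j => fits_fill _ _ _ _]]
  linarith [le_kolSinai_templateMeasure (S.τ n) (hh n)]

end TemplateFamily

/-! ### The concrete templates -/

/-- The word `0001` followed by `k` pairs `1*` and by pairs `01`. -/
def markedWord (k r : ℕ) : Option Bool :=
  if r < 3 then some false
  else if r = 3 then some true
  else if r % 2 = 0 then some (decide ((r - 4) / 2 < k))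
  else if (r - 5) / 2 < k then none else some true

lemma compat_some {b c : Bool} : Compat (some c) b ↔ c = b := by simp [Compat]

lemma markedWord_lt {k r : ℕ} (h : r < 3) : markedWord k r = some false := if_pos h

lemma markedWord_three {k : ℕ} : markedWord k 3 = some true := rfl

lemma markedWord_even {k r : ℕ} (h : 4 ≤ r) (h2 : r % 2 = 0) :
    markedWord k r = some (decide ((r - 4) / 2 < k)) := by
  rw [markedWord, if_neg (by omega), if_neg (by omega), if_pos h2]

lemma markedWord_odd {k r : ℕ} (h : 5 ≤ r) (h2 : r % 2 = 1) :
    markedWord k r = if (r - 5) / 2 < k then none else some true := by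
  rw [markedWord, if_neg (by omega), if_neg (by omega), if_neg (by omega)]

lemma sum_bits_markedWord (k j : ℕ) :
    ∑ r ∈ Finset.range (4 + 2 * j), bits (markedWord k r) = (min k j : ℕ) := by
  induction j with
  | zero => simp [Finset.sum_range_succ, markedWord, bits]
  | succ j ih =>
    rw [show 4 + 2 * (j + 1) = 4 + 2 * j + 1 + 1 by ring, Finset.sum_range_succ,
      Finset.sum_range_succ, ih, markedWord_even (by omega) (by omega),
      markedWord_odd (by omega) (by omega), show (4 + 2 * j + 1 - 5) / 2 = j by omega]
    by_cases hj : j < k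
    · rw [if_pos hj, Nat.min_eq_right hj.le, Nat.min_eq_right hj]
      simp [bits]
    · rw [if_neg hj, Nat.min_eq_left (by omega), Nat.min_eq_left (by omega)]
      simp [bits]

lemma markedWord_unique {K k l q : ℕ} (hk : k ≤ K) (hl : l ≤ K) (hq : q < 4 + 2 * K) {u : ℕ → Bool}
    (h1 : ∀ r < 4 + 2 * K, Compat (markedWord k r) (u r))
    (h2 : ∀ r < 4 + 2 * K, Compat (markedWord l ((q + r) % (4 + 2 * K))) (u r)) :
    q = 0 ∧ k = l := by
  have u0 : ∀ r < 3, u r = false := fun r hr => by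
    have := h1 r (by omega)
    rw [markedWord_lt hr, compat_some] at this
    exact this.symm
  have u3 : u 3 = true := by
    have := h1 3 (by omega)
    rw [markedWord_three, compat_some] at this
    exact this.symm
  have h3 : ∀ r, r < 3 → q + r = 3 → False := fun r hr e => by
    have := h2 r (by omega)
    rw [e, Nat.mod_eq_of_lt (by omega), markedWord_three, compat_some, u0 r hr] at this
    exact absurd this (by decide)
  have heven : ∀ r, r < 2 → 4 ≤ q + r → (q + r) % 2 = 0 → q + r < 4 + 2 * K → False := by
    intro r hr h4 he hlt
    have e1 := h2 r (by omega)
    rw [Nat.mod_eq_of_lt hlt, markedWord_even h4 he, compat_some, u0 r (by omega),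
      decide_eq_false_iff_not] at e1
    have e2 := h2 (r + 1) (by omega)
    rw [Nat.mod_eq_of_lt (by omega), markedWord_odd (by omega) (by omega), if_neg (by omega),
      compat_some, u0 (r + 1) (by omega)] at e2
    exact absurd e2 (by decide)
  have hq0 : q = 0 := by
    by_contra hq0
    by_cases hq3 : q ≤ 3
    · exact h3 (3 - q) (by omega) (by omega)
    · rcases Nat.mod_two_eq_zero_or_one q with he | he
      · exact heven 0 (by omega) (by omega) (by omega) (by omega)
      · by_cases hq1 : q + 1 < 4 + 2 * K
        · exact heven 1 (by omega) (by omega) (by omega) hq1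
        · have e := h2 3 (by omega)
          have e' : (q + 3) % (4 + 2 * K) = 2 := by
            rw [show q + 3 = 2 + (4 + 2 * K) by omega, Nat.add_mod_right,
              Nat.mod_eq_of_lt (by omega)]
          rw [e', markedWord_lt (by omega), compat_some, u3] at e
          exact absurd e (by decide)
  refine ⟨hq0, ?_⟩
  subst hq0
  have hr : ∀ r < K, (r < k ↔ r < l) := fun r hr => by
    have e1 := h1 (4 + 2 * r) (by omega)
    have e2 := h2 (4 + 2 * r) (by omega)
    rw [zero_add, Nat.mod_eq_of_lt (by omega), markedWord_even (by omega) (by omega),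
      compat_some] at e2
    rw [markedWord_even (by omega) (by omega), compat_some, ← e2, decide_eq_decide] at e1
    rwa [show (4 + 2 * r - 4) / 2 = r by omega] at e1
  by_contra hne
  rcases Nat.lt_or_gt_of_ne hne with h | h
  · exact absurd ((hr k (by omega)).2 h) (lt_irrefl _)
  · exact absurd ((hr l (by omega)).1 h) (lt_irrefl _)

/-- The family of the periodic repetitions of the marked words with at most `K` free pairs. -/
def markedFamily (K : ℕ) {ι : Type} (κ : ι → ℕ) (hκ : ∀ n, κ n ≤ K)
    (hinj : Function.Injective κ) : TemplateFamily (4 + 2 * K) ι where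
  τ n θ := markedWord (κ n) θ.val
  M := 2 * (4 + 2 * K)
  unique := by
    rintro ⟨n, θ⟩ ⟨n', θ'⟩ x h1 h2
    have : NeZero (4 + 2 * K) := ⟨by omega⟩
    have hθ := ZMod.val_lt θ
    have hcast : ∀ (φ : ZMod (4 + 2 * K)) (r : ℕ), r < 4 + 2 * K →
        φ - ((θ.val + (4 + 2 * K) - r : ℕ) : ZMod (4 + 2 * K)) = ((φ - θ).val + r : ℕ) := by
      intro φ r hr
      rw [Nat.cast_sub (by omega), Nat.cast_add _ (4 + 2 * K), Nat.cast_add _ r,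
        ZMod.natCast_zmod_val, ZMod.natCast_zmod_val, ZMod.natCast_self]
      ring
    have key := markedWord_unique (u := fun r => x (-((θ.val + (4 + 2 * K) - r : ℕ) : ℤ)))
      (hκ n) (hκ n') (ZMod.val_lt (θ' - θ))
      (fun r hr => by
        have := h1 (θ.val + (4 + 2 * K) - r) (by omega)
        dsimp only at this
        rwa [hcast θ r hr, sub_self, ZMod.val_zero, zero_add, ZMod.val_natCast_of_lt hr] at this)
      (fun r hr => by
        have := h2 (θ.val + (4 + 2 * K) - r) (by omega)
        dsimp only at this
        rwa [hcast θ' r hr, ZMod.val_natCast] at this)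
    rw [ZMod.val_eq_zero, sub_eq_zero] at key
    rw [hinj key.2, key.1]

lemma sum_bits_markedFamily {K : ℕ} [NeZero (4 + 2 * K)] {ι : Type} {κ : ι → ℕ}
    (hκ : ∀ n, κ n ≤ K) (hinj : Function.Injective κ) (n : ι) :
    ∑ θ, bits ((markedFamily K κ hκ hinj).τ n θ) = κ n := by
  rw [sum_zmod_eq_sum_range, ← Nat.min_eq_left (hκ n), ← sum_bits_markedWord]
  refine Finset.sum_congr rfl fun r hr => ?_
  simp only [markedFamily]
  rw [ZMod.val_natCast_of_lt (Finset.mem_range.1 hr)]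

/-! ### Piecewise affine functions -/

/-- A continuous piecewise affine function with distinct consecutive slopes is differentiable
precisely outside of the breakpoints. -/
lemma not_differentiableWithinAt_iff {α : ℝ} {N : ℕ} {β s d : ℕ → ℝ} {F : ℝ → ℝ}
    (hα : ∀ n, 1 ≤ n → n ≤ N → α < β n) (hmono : ∀ n, 1 ≤ n → n < N → β n < β (n + 1))
    (hs : ∀ n < N, s n ≠ s (n + 1))
    (hF : ∀ n ≤ N, ∀ t, α ≤ t → (n = 0 ∨ β n ≤ t) → (n = N ∨ t ≤ β (n + 1)) →
      F t = s n * t + d n) {b : ℝ} (hb : α ≤ b) :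
    ¬ DifferentiableWithinAt ℝ F (Set.Ici α) b ↔ ∃ n : ℕ, 1 ≤ n ∧ n ≤ N ∧ β n = b := by
  have haff : ∀ n (u : Set ℝ), HasDerivWithinAt (fun t => s n * t + d n) (s n) u b := fun n u => by
    simpa using (((hasDerivAt_id b).const_mul (s n)).add_const (d n)).hasDerivWithinAt (s := u)
  constructor
  · intro hnd
    by_contra hne
    push Not at hne
    refine hnd ?_
    classical
    obtain ⟨n, hnN, hn0, hn1⟩ : ∃ n ≤ N, (n = 0 ∨ β n ≤ b) ∧ (n = N ∨ b < β (n + 1)) := by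
      let P : ℕ → Prop := fun n => n = 0 ∨ β n ≤ b
      refine ⟨Nat.findGreatest P N, Nat.findGreatest_le N,
        Nat.findGreatest_spec (P := P) (Nat.zero_le N) (Or.inl rfl), ?_⟩
      rcases (Nat.findGreatest_le (P := P) N).eq_or_lt with h | h
      · exact Or.inl h
      · have := Nat.findGreatest_is_greatest (P := P) (Nat.lt_succ_self _) h
        simp only [P, not_or, not_le] at this
        exact Or.inr this.2
    have h0 : ∀ᶠ t in 𝓝 b, n = 0 ∨ β n ≤ t := by
      rcases Nat.eq_zero_or_pos n with h | h
      · exact Eventually.of_forall fun _ => Or.inl h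
      · have : β n < b := (hn0.resolve_left h.ne').lt_of_ne (hne n h hnN)
        filter_upwards [lt_mem_nhds this] with t ht using Or.inr ht.le
    have h1 : ∀ᶠ t in 𝓝 b, n = N ∨ t ≤ β (n + 1) := by
      rcases hn1 with h | h
      · exact Eventually.of_forall fun _ => Or.inl h
      · filter_upwards [gt_mem_nhds h] with t ht using Or.inr ht.le
    have heq : F =ᶠ[𝓝[Set.Ici α] b] fun t => s n * t + d n := by
      filter_upwards [mem_nhdsWithin_of_mem_nhds h0, mem_nhdsWithin_of_mem_nhds h1,
        self_mem_nhdsWithin] with t ht0 ht1 ht using hF n hnN t ht ht0 ht1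
    exact ((haff n _).congr_of_eventuallyEq_of_mem heq hb).differentiableWithinAt
  · rintro ⟨n, hn1, hnN, rfl⟩ hd
    obtain ⟨m, rfl⟩ : ∃ m, n = m + 1 := ⟨n - 1, by omega⟩
    obtain ⟨l, hl, hlα, hl'⟩ : ∃ l < β (m + 1), α ≤ l ∧ (m = 0 ∨ β m ≤ l) := by
      rcases Nat.eq_zero_or_pos m with h | h
      · exact ⟨α, hα _ hn1 hnN, le_rfl, Or.inl h⟩
      · exact ⟨β m, hmono m h (by omega), (hα m h (by omega)).le, Or.inr le_rfl⟩
    obtain ⟨u, hu, hu'⟩ : ∃ u, β (m + 1) < u ∧ (m + 1 = N ∨ u ≤ β (m + 1 + 1)) := by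
      rcases hnN.eq_or_lt with h | h
      · exact ⟨β (m + 1) + 1, by linarith, Or.inl h⟩
      · exact ⟨β (m + 1 + 1), hmono _ hn1 h, Or.inr le_rfl⟩
    have hl2 : HasDerivWithinAt F (s m) (Set.Icc l (β (m + 1))) (β (m + 1)) :=
      (haff m _).congr_of_mem (fun t ht => hF m (by omega) t (hlα.trans ht.1)
        (hl'.imp_right fun h => h.trans ht.1) (Or.inr ht.2)) ⟨hl.le, le_rfl⟩
    have hu2 : HasDerivWithinAt F (s (m + 1)) (Set.Icc (β (m + 1)) u) (β (m + 1)) :=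
      (haff (m + 1) _).congr_of_mem (fun t ht => hF (m + 1) hnN t (hb.trans ht.1)
        (Or.inr ht.1) (hu'.imp_right fun h => ht.2.trans h)) ⟨le_rfl, hu.le⟩
    have hd' := hd.hasDerivWithinAt
    have e1 := ((uniqueDiffOn_Icc hl) _ ⟨hl.le, le_rfl⟩).eq_deriv _ hl2
      (hd'.mono fun t ht => hlα.trans ht.1)
    have e2 := ((uniqueDiffOn_Icc hu) _ ⟨le_rfl, hu.le⟩).eq_deriv _ hu2
      (hd'.mono fun t ht => hb.trans ht.1)
    exact hs m (by omega) (e1.trans e2.symm)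

/-- Affine functions whose increments change sign at increasing breakpoints: between two
consecutive breakpoints, the corresponding affine function is the maximum. -/
lemma le_of_increments {N n : ℕ} {β a : ℕ → ℝ} {t : ℝ} (hn : n ≤ N)
    (hmono : ∀ n, 1 ≤ n → n < N → β n < β (n + 1))
    (hup : ∀ m < N, β (m + 1) ≤ t → a m ≤ a (m + 1))
    (hdown : ∀ m < N, t ≤ β (m + 1) → a (m + 1) ≤ a m)
    (h0 : n = 0 ∨ β n ≤ t) (h1 : n = N ∨ t ≤ β (n + 1)) {m : ℕ} (hm : m ≤ N) : a m ≤ a n := by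
  have hβ : ∀ i j, 1 ≤ i → i ≤ j → j ≤ N → β i ≤ β j := by
    intro i j hi hij
    induction j, hij using Nat.le_induction with
    | base => exact fun _ => le_rfl
    | succ j hij ih => exact fun hj => (ih (by omega)).trans (hmono j (by omega) hj).le
  rcases le_total m n with h | h
  · have hn' : ∀ j, m ≤ j → j ≤ n → a m ≤ a j := by
      intro j hj
      induction j, hj using Nat.le_induction with
      | base => exact fun _ => le_rfl
      | succ j hj ih =>
        exact fun hjn => (ih (by omega)).trans (hup j (by omega)
          ((hβ _ n (by omega) hjn hn).trans (h0.resolve_left (by omega))))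
    exact hn' n h le_rfl
  · have hn' : ∀ j, n ≤ j → j ≤ N → a j ≤ a n := by
      intro j hj
      induction j, hj using Nat.le_induction with
      | base => exact fun _ => le_rfl
      | succ j hj ih =>
        exact fun hjN => (hdown j (by omega) ((h1.resolve_left (by omega)).trans
          (hβ (n + 1) _ (by omega) (by omega) hjN))).trans (ih (by omega))
    exact hn' m h hm

/-- Corollary (finitely many phase transitions). -/
theorem finite_case (α : ℝ) (hα : 0 < α) (N : ℕ) (hN : 1 ≤ N) (β : ℕ → ℝ)
    (h1 : α < β 1) (hmono : ∀ n : ℕ, 1 ≤ n → n < N → β n < β (n + 1)) :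
    ∃ φ : Bin → ℝ, Continuous φ ∧
      ∀ b : ℝ, α ≤ b →
        (¬ DifferentiableWithinAt ℝ
            (fun t : ℝ => pressure shift (fun x => t * φ x)) (Set.Ici α) b ↔
          ∃ n : ℕ, 1 ≤ n ∧ n ≤ N ∧ β n = b) := by
  have hβα : ∀ n, 1 ≤ n → n ≤ N → α < β n := by
    intro n hn
    induction n, hn using Nat.le_induction with
    | base => exact fun _ => h1
    | succ n hn ih => exact fun h => (ih (by omega)).trans (hmono n hn h)
  have hκ : ∀ n : Fin (N + 1), N + 1 - (n : ℕ) ≤ N + 1 := fun n => Nat.sub_le _ _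
  have hinj : Function.Injective fun n : Fin (N + 1) => N + 1 - (n : ℕ) := fun n m h => by
    have := n.2
    have := m.2
    ext
    dsimp only at h
    omega
  have : NeZero (4 + 2 * (N + 1)) := ⟨by omega⟩
  let S := markedFamily (N + 1) (fun n : Fin (N + 1) => N + 1 - (n : ℕ)) hκ hinj
  set p : ℝ := ((4 + 2 * (N + 1) : ℕ) : ℝ) with hp
  have hp0 : 0 < p := by
    rw [hp]
    positivity
  let s : ℕ → ℝ := fun n => ∑ j ∈ Finset.range n, 1 / (p * β (j + 1))
  let d : ℕ → ℝ := fun n => ((N : ℝ) + 1 - n) / p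
  let D : ℝ := (2 * p + 9) / α
  have hD0 : 0 ≤ D := by positivity
  have hD : ∀ t, α ≤ t → 2 * p + 9 ≤ t * D := fun t ht => by
    have : α * D = 2 * p + 9 := mul_div_cancel₀ _ hα.ne'
    rw [← this]
    gcongr
  have hinc : ∀ n t, (s (n + 1) * t + d (n + 1)) - (s n * t + d n) = (t / β (n + 1) - 1) / p := by
    intro n t
    simp only [s, d, Finset.sum_range_succ]
    push_cast
    ring
  refine ⟨S.pot (fun n => s n) D, S.continuous_pot _ _, fun b hb =>
    not_differentiableWithinAt_iff (s := s) (d := d) hβα hmono (fun n hn h => ?_)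
      (fun n hn t ht h0 h1' => ?_) hb⟩
  · have hpos : 0 < 1 / (p * β (n + 1)) :=
      one_div_pos.2 (mul_pos hp0 (hα.trans (hβα _ (by omega) hn)))
    simp only [s, Finset.sum_range_succ] at h
    linarith
  · have ht0 : 0 ≤ t := hα.le.trans ht
    have hmax : ∀ m ≤ N, s m * t + d m ≤ s n * t + d n := fun m hm =>
      le_of_increments (a := fun m => s m * t + d m) hn hmono
        (fun m hm h => by
          have hpos := hα.trans (hβα (m + 1) (by omega) hm)
          have : 0 ≤ (t / β (m + 1) - 1) / p :=
            div_nonneg (sub_nonneg.2 ((one_le_div hpos).2 h)) hp0.le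
          linarith [hinc m t])
        (fun m hm h => by
          have hpos := hα.trans (hβα (m + 1) (by omega) hm)
          have : (t / β (m + 1) - 1) / p ≤ 0 :=
            div_nonpos_of_nonpos_of_nonneg (sub_nonpos.2 ((div_le_one hpos).2 h)) hp0.le
          linarith [hinc m t]) h0 h1' hm
    refine S.pressure_pot (h := fun n => d n) ht0 hD0 (hD t ht) (fun m => ?_) ?_ (fun m => ?_)
      ⟨⟨n, by omega⟩, by ring⟩
    · rw [sum_bits_markedFamily, Nat.cast_sub m.2.le]
      simp only [d]
      rw [mul_div_cancel₀ _ hp0.ne']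
      push_cast
      ring
    · refine le_trans ?_ (hmax 0 (Nat.zero_le N))
      simp only [s, d, Finset.range_zero, Finset.sum_empty, zero_mul, zero_add, Nat.cast_zero, sub_zero]
      positivity
    · have := hmax m (Nat.lt_succ_iff.1 m.2)
      linarith

end PhaseTransitions
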